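/- In a nice embedding of a cluster quiver Q of simply-laced finite type in the plane, the boundary of each bounded cell (bounded connected component of the complement) is an oriented cycle in Q, and there are no other edges of Q between the vertices of that cycle. -/

import Mathlib

noncomputable section

/-- Fomin–Zelevinsky mutation of an exchange matrix in direction `k`. -/
def clusterMutate {n : ℕ} (B : Matrix (Fin n) (Fin n) ℤ) (k : Fin n) :
    Matrix (Fin n) (Fin n) ℤ :=
  Matrix.of fun i j =>
    if i = k ∨ j = k then -B i j
    else B i j + (|B i k| * B k j + B i k * |B k j|) / 2

/-- Mutation equivalence of exchange matrices. -/
def MutationEquiv {n : ℕ} (B B' : Matrix (Fin n) (Fin n) ℤ) : Prop :=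
  Relation.ReflTransGen (fun X Y => ∃ k, Y = clusterMutate X k) B B'

/-- Adjacency in the Dynkin diagram `A_n`. -/
def adjA (n : ℕ) (i j : Fin n) : Prop := (i : ℕ) + 1 = j ∨ (j : ℕ) + 1 = i

/-- Adjacency in the Dynkin diagram `D_n`. -/
def adjD (n : ℕ) (i j : Fin n) : Prop :=
  ((i : ℕ) + 1 = j ∧ (j : ℕ) ≤ n - 2) ∨ ((j : ℕ) + 1 = i ∧ (i : ℕ) ≤ n - 2) ∨
    ((i : ℕ) = n - 3 ∧ (j : ℕ) = n - 1) ∨ ((j : ℕ) = n - 3 ∧ (i : ℕ) = n - 1)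

/-- Adjacency in the Dynkin diagram `E_n` (`n ∈ {6,7,8}`). -/
def adjE (n : ℕ) (i j : Fin n) : Prop :=
  ((i : ℕ) + 1 = j ∧ (j : ℕ) ≤ n - 2) ∨ ((j : ℕ) + 1 = i ∧ (i : ℕ) ≤ n - 2) ∨
    ((i : ℕ) = 2 ∧ (j : ℕ) = n - 1) ∨ ((j : ℕ) = 2 ∧ (i : ℕ) = n - 1)

/-- `B` is the skew-symmetric exchange matrix of an orientation of the graph `adj`. -/
def IsOrientationOf {n : ℕ} (B : Matrix (Fin n) (Fin n) ℤ)
    (adj : Fin n → Fin n → Prop) : Prop :=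
  (∀ i j, B j i = -B i j) ∧ (∀ i j, |B i j| ≤ 1) ∧ ∀ i j, B i j ≠ 0 ↔ adj i j

/-- `B` is an orientation of a simply laced Dynkin diagram (type `A`, `D` or `E`). -/
def IsDynkinADEOrientation {n : ℕ} (B : Matrix (Fin n) (Fin n) ℤ) : Prop :=
  IsOrientationOf B (adjA n) ∨ (4 ≤ n ∧ IsOrientationOf B (adjD n)) ∨
    ((n = 6 ∨ n = 7 ∨ n = 8) ∧ IsOrientationOf B (adjE n))

/-- A cluster quiver (exchange matrix) of simply laced finite type: one which is
mutation equivalent to an orientation of a Dynkin diagram of type `A`, `D` or `E`.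
There is an arrow `i → j` of the quiver precisely when `B i j > 0`. -/
def IsFiniteTypeClusterMatrix {n : ℕ} (B : Matrix (Fin n) (Fin n) ℤ) : Prop :=
  ∃ B₀, IsDynkinADEOrientation B₀ ∧ MutationEquiv B₀ B

/-- An embedding of the quiver on `Fin n` with arrow relation `arr` in the plane:
vertices are distinct points, each arrow is drawn as an injective continuous curve
from its source to its target, the open arcs of different arrows are disjoint from
each other and from all other arrow curves, and avoid the vertices. -/
structure PlaneEmb {n : ℕ} (arr : Fin n → Fin n → Prop) where
  vtx : Fin n → ℝ × ℝ
  vtx_inj : Function.Injective vtx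
  edge : ∀ i j : Fin n, arr i j → ℝ → ℝ × ℝ
  edge_cont : ∀ i j h, ContinuousOn (edge i j h) (Set.Icc 0 1)
  edge_src : ∀ i j h, edge i j h 0 = vtx i
  edge_tgt : ∀ i j h, edge i j h 1 = vtx j
  edge_inj : ∀ i j h, Set.InjOn (edge i j h) (Set.Icc 0 1)
  edge_disj : ∀ i j h i' j' h', (i, j) ≠ (i', j') →
    (edge i j h '' Set.Ioo 0 1) ∩ (edge i' j' h' '' Set.Icc 0 1) = ∅
  edge_vtx : ∀ i j h v, vtx v ∉ edge i j h '' Set.Ioo 0 1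

/-- The image of a plane embedding of a quiver: the union of the vertex points and of
the arrow curves. -/
def PlaneEmb.image {n : ℕ} {arr : Fin n → Fin n → Prop} (E : PlaneEmb arr) :
    Set (ℝ × ℝ) :=
  Set.range E.vtx ∪ ⋃ (i) (j) (h : arr i j), E.edge i j h '' Set.Icc 0 1

/-- The union of the unbounded connected components of the complement of `S`. -/
def unboundedPart (S : Set (ℝ × ℝ)) : Set (ℝ × ℝ) :=
  {x | x ∉ S ∧ ¬Bornology.IsBounded (connectedComponentIn Sᶜ x)}

/-- A plane embedding of a quiver is nice if the complement of its image has a unique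
unbounded connected component (i.e. the union of the unbounded components is
connected) and every vertex belongs to the closure of that component. -/
def PlaneEmb.Nice {n : ℕ} {arr : Fin n → Fin n → Prop} (E : PlaneEmb arr) : Prop :=
  IsPreconnected (unboundedPart E.image) ∧
    ∀ v, E.vtx v ∈ closure (unboundedPart E.image)

theorem clusterMutate_left {n : ℕ} (B : Matrix (Fin n) (Fin n) ℤ) (k j : Fin n) :
    clusterMutate B k k j = -B k j := by
  simp [clusterMutate]

theorem clusterMutate_right {n : ℕ} (B : Matrix (Fin n) (Fin n) ℤ) (k i : Fin n) :
    clusterMutate B k i k = -B i k := by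
  simp [clusterMutate]

theorem clusterMutate_of_nonpos {n : ℕ} {B : Matrix (Fin n) (Fin n) ℤ} {k i j : Fin n}
    (hi : i ≠ k) (hj : j ≠ k) (h : B i k * B k j ≤ 0) : clusterMutate B k i j = B i j := by
  have h0 : |B i k| * B k j + B i k * |B k j| = 0 := by
    rcases le_total 0 (B i k) with ha | ha <;> rcases le_total 0 (B k j) with hb | hb <;>
      simp only [abs_of_nonneg, abs_of_nonpos, ha, hb] <;> nlinarith
  simp [clusterMutate, hi, hj, h0]

theorem clusterMutate_of_pos {n : ℕ} {B : Matrix (Fin n) (Fin n) ℤ} {k i j : Fin n}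
    (hi : i ≠ k) (hj : j ≠ k) (h : B i k = 1) (h' : B k j = 1) :
    clusterMutate B k i j = B i j + 1 := by
  simp [clusterMutate, hi, hj, h, h']

theorem clusterMutate_of_neg {n : ℕ} {B : Matrix (Fin n) (Fin n) ℤ} {k i j : Fin n}
    (hi : i ≠ k) (hj : j ≠ k) (h : B i k = -1) (h' : B k j = -1) :
    clusterMutate B k i j = B i j - 1 := by
  simp [clusterMutate, hi, hj, h, h']
  ring

/-- All entries of the matrix are `0`, `1` or `-1`. -/
def IsSignMatrix {n : ℕ} (B : Matrix (Fin n) (Fin n) ℤ) : Prop :=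
  ∀ i j, B i j = 0 ∨ B i j = 1 ∨ B i j = -1

theorem clusterMutate_clusterMutate {n : ℕ} {B : Matrix (Fin n) (Fin n) ℤ}
    (hB : IsSignMatrix B) (k : Fin n) : clusterMutate (clusterMutate B k) k = B := by
  ext i j
  by_cases hi : i = k
  · subst hi; simp [clusterMutate_left]
  by_cases hj : j = k
  · subst hj; simp [clusterMutate_right]
  have hl : ∀ C : Matrix (Fin n) (Fin n) ℤ, clusterMutate C k i j =
      C i j + (|C i k| * C k j + C i k * |C k j|) / 2 := fun C => by
    simp [clusterMutate, hi, hj]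
  rw [hl, clusterMutate_left, clusterMutate_right, hl]
  rcases hB i k with h | h | h <;> rcases hB k j with h' | h' | h' <;> rw [h, h'] <;>
    norm_num

theorem clusterMutate_neg {n : ℕ} {B : Matrix (Fin n) (Fin n) ℤ}
    (hB : IsSignMatrix B) (k : Fin n) : clusterMutate (-B) k = -clusterMutate B k := by
  ext i j
  by_cases hi : i = k
  · subst hi; simp [clusterMutate_left]
  by_cases hj : j = k
  · subst hj; simp [clusterMutate_right]
  simp only [clusterMutate, hi, hj, Matrix.neg_apply, Matrix.of_apply, or_self, if_false]
  rcases hB i k with h | h | h <;> rcases hB k j with h' | h' | h' <;> rw [h, h'] <;>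
    norm_num <;> ring

theorem clusterMutate_skew {n : ℕ} {B : Matrix (Fin n) (Fin n) ℤ}
    (hB : IsSignMatrix B) (hs : ∀ i j, B j i = -B i j) (k i j : Fin n) :
    clusterMutate B k j i = -clusterMutate B k i j := by
  by_cases hi : i = k
  · subst hi; simp [clusterMutate_left, clusterMutate_right, hs i j]
  by_cases hj : j = k
  · subst hj; simp [clusterMutate_left, clusterMutate_right, hs i j]
  simp only [clusterMutate, hi, hj, Matrix.of_apply, or_self, if_false]
  rw [hs k j, hs i k, hs i j]
  rcases hB i k with h | h | h <;> rcases hB k j with h' | h' | h' <;> rw [h, h'] <;>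
    norm_num <;> ring

/-- A symmetric positive definite integer matrix `A` with diagonal entries `2` whose
off-diagonal entries agree up to sign with those of `B`. -/
structure IsPositiveCompanion {n : ℕ} (A B : Matrix (Fin n) (Fin n) ℤ) : Prop where
  symm : ∀ i j, A i j = A j i
  diag : ∀ i, A i i = 2
  abs_eq : ∀ i j, i ≠ j → |A i j| = |B i j|
  pos : ∀ x : Fin n → ℤ, x ≠ 0 → 0 < x ⬝ᵥ A.mulVec x

namespace IsPositiveCompanion

variable {n : ℕ} {A B : Matrix (Fin n) (Fin n) ℤ}

theorem dotProduct_comm (h : IsPositiveCompanion A B) (x y : Fin n → ℤ) :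
    x ⬝ᵥ A.mulVec y = y ⬝ᵥ A.mulVec x := by
  have hA : A.transpose = A := by ext i j; exact h.symm j i
  rw [Matrix.dotProduct_mulVec, _root_.dotProduct_comm, ← Matrix.mulVec_transpose, hA]

theorem norm_add_smul (h : IsPositiveCompanion A B) (x y : Fin n → ℤ) (a : ℤ) :
    (x + a • y) ⬝ᵥ A.mulVec (x + a • y) =
      x ⬝ᵥ A.mulVec x + 2 * a * (x ⬝ᵥ A.mulVec y) + a ^ 2 * (y ⬝ᵥ A.mulVec y) := by
  simp only [Matrix.mulVec_add, Matrix.mulVec_smul, add_dotProduct, dotProduct_add,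
    smul_dotProduct, dotProduct_smul, smul_eq_mul]
  rw [h.dotProduct_comm y x]
  ring

/-- Two vectors of norm two that are not proportional have inner product `0` or `±1`. -/
theorem abs_inner_le_one (h : IsPositiveCompanion A B) {x y : Fin n → ℤ}
    (hx : x ⬝ᵥ A.mulVec x = 2) (hy : y ⬝ᵥ A.mulVec y = 2) (h1 : x ≠ y) (h2 : x ≠ -y) :
    |x ⬝ᵥ A.mulVec y| ≤ 1 := by
  have e1 := h.pos (x + (1 : ℤ) • y) (by
    intro h0; apply h2; rw [one_smul] at h0; exact eq_neg_of_add_eq_zero_left h0)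
  have e2 := h.pos (x + (-1 : ℤ) • y) (by
    intro h0; apply h1; rw [neg_one_smul, ← sub_eq_add_neg] at h0; exact sub_eq_zero.mp h0)
  rw [h.norm_add_smul, hx, hy] at e1 e2
  rw [abs_le]
  constructor <;> linarith

/-- Three vectors of norm two that are pairwise non-orthogonal and independent have inner
products with positive product. -/
theorem inner_mul_inner_mul_inner (h : IsPositiveCompanion A B) {x y z : Fin n → ℤ} {a b c : ℤ}
    (hx : x ⬝ᵥ A.mulVec x = 2) (hy : y ⬝ᵥ A.mulVec y = 2) (hz : z ⬝ᵥ A.mulVec z = 2)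
    (hxy : x ⬝ᵥ A.mulVec y = a) (hyz : y ⬝ᵥ A.mulVec z = b) (hxz : x ⬝ᵥ A.mulVec z = c)
    (_ : a ^ 2 = 1) (_ : c ^ 2 = 1)
    (h0 : x + (-a) • y + (-c) • z ≠ 0) : -1 < a * b * c := by
  have e := h.pos _ h0
  rw [h.norm_add_smul, h.norm_add_smul, hx, hy, hz, hxy, add_dotProduct, smul_dotProduct, hxz,
    hyz, smul_eq_mul] at e
  nlinarith

theorem single_inner_single (A : Matrix (Fin n) (Fin n) ℤ) (i j : Fin n) :
    (Pi.single i 1 : Fin n → ℤ) ⬝ᵥ A.mulVec (Pi.single j 1) = A i j := by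
  simp

theorem isSignMatrix_companion (h : IsPositiveCompanion A B) {i j : Fin n} (hij : i ≠ j) :
    |A i j| ≤ 1 := by
  rw [← single_inner_single A i j]
  apply h.abs_inner_le_one
  · rw [single_inner_single, h.diag]
  · rw [single_inner_single, h.diag]
  · intro e
    have := congrFun e i
    simp [hij] at this
  · intro e
    have := congrFun e i
    simp [hij] at this

theorem isSignMatrix (h : IsPositiveCompanion A B) (hs : ∀ i j, B j i = -B i j) :
    IsSignMatrix B := by
  intro i j
  by_cases hij : i = j
  · subst hij; left; have := hs i i; omega
  · have h1 := h.isSignMatrix_companion hij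
    rw [h.abs_eq i j hij, abs_le] at h1
    omega

theorem sq_eq_one (h : IsPositiveCompanion A B) {i j : Fin n} (hij : i ≠ j) (hB : B i j ≠ 0) :
    A i j ^ 2 = 1 := by
  have h1 := h.isSignMatrix_companion hij
  have h2 : A i j ≠ 0 := fun h0 => hB (by simpa [h0] using (h.abs_eq i j hij).symm)
  rw [abs_le] at h1
  have : A i j = 1 ∨ A i j = -1 := by omega
  rcases this with e | e <;> rw [e] <;> norm_num

theorem eq_zero (h : IsPositiveCompanion A B) {i j : Fin n} (hij : i ≠ j) (hB : B i j = 0) :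
    A i j = 0 := by
  simpa [hB] using h.abs_eq i j hij

end IsPositiveCompanion

theorem IsPositiveCompanion.triangle {n : ℕ} {A B : Matrix (Fin n) (Fin n) ℤ}
    (h : IsPositiveCompanion A B) {i j k : Fin n} (hij : i ≠ j) (hjk : j ≠ k) (hik : i ≠ k)
    (bij : B i j ≠ 0) (bjk : B j k ≠ 0) (bik : B i k ≠ 0) : A i j * A j k = A i k := by
  have s1 := h.sq_eq_one hij bij
  have s2 := h.sq_eq_one hjk bjk
  have s3 := h.sq_eq_one hik bik
  have key := h.inner_mul_inner_mul_inner (x := Pi.single i 1) (y := Pi.single j 1)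
    (z := Pi.single k 1) (a := A i j) (b := A j k) (c := A i k)
    (by simp [h.diag]) (by simp [h.diag]) (by simp [h.diag]) (by simp) (by simp) (by simp)
    s1 s3 (by
      intro e
      have := congrFun e i
      simp [hij, hik] at this)
  rw [sq_eq_one_iff] at s1 s2 s3
  rcases s1 with e1 | e1 <;> rcases s2 with e2 | e2 <;> rcases s3 with e3 | e3 <;>
    first
    | (norm_num [e1, e2, e3]; done)
    | norm_num [e1, e2, e3] at key

theorem IsPositiveCompanion.exists_clusterMutate {n : ℕ} {A B : Matrix (Fin n) (Fin n) ℤ}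
    (h : IsPositiveCompanion A B) (hs : ∀ i j, B j i = -B i j) (k : Fin n)
    (htri : ∀ i j, B i k = 1 → B k j = 1 → B i j ≠ 1) :
    ∃ A', IsPositiveCompanion A' (clusterMutate B k) := by
  have hsign := h.isSignMatrix hs
  set ε : Fin n → ℤ := fun i => if B i k = 1 then 1 else 0 with hε
  have hkk : B k k = 0 := by have := hs k k; omega
  have εk : ε k = 0 := by simp [hε, hkk]
  set A' : Matrix (Fin n) (Fin n) ℤ := Matrix.of fun i j =>
    A i j - (ε i + ε j) * (A i k * A k j) + 2 * (ε i * ε j) * (A i k * A k j) with hA'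
  refine ⟨A', ⟨?_, ?_, ?_, ?_⟩⟩
  · intro i j
    simp only [hA', Matrix.of_apply]
    rw [h.symm j i, h.symm j k, h.symm k i]
    ring
  · intro i
    simp only [hA', Matrix.of_apply, hε, h.symm k i]
    split_ifs <;> rw [h.diag] <;> ring
  · intro i j hij
    by_cases hi : i = k
    · subst hi
      rw [clusterMutate_left, abs_neg, ← h.abs_eq _ _ hij]
      simp only [hA', Matrix.of_apply, εk, h.diag]
      by_cases hj : B j i = 1
      · simp only [hε, hj, if_true]
        rw [show A i j - (0 + 1) * (2 * A i j) + 2 * (0 * 1) * (2 * A i j) = -A i j by ring,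
          abs_neg]
      · simp [hε, hj]
    by_cases hj : j = k
    · subst hj
      rw [clusterMutate_right, abs_neg, ← h.abs_eq _ _ hij]
      simp only [hA', Matrix.of_apply, εk, h.diag]
      by_cases hi' : B i j = 1
      · simp only [hε, hi', if_true]
        rw [show A i j - (1 + 0) * (A i j * 2) + 2 * (1 * 0) * (A i j * 2) = -A i j by ring,
          abs_neg]
      · simp [hε, hi']
    have main : ∀ i j, i ≠ j → i ≠ k → j ≠ k → B i k = 1 → B k j = 1 →
        |A i j - A i k * A k j| = |B i j + 1| := by
      intro i j hij hi hj h1 h2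
      rcases hsign i j with e | e | e
      · rw [h.eq_zero hij e, e, zero_sub, abs_neg, abs_mul, h.abs_eq _ _ hi,
          h.abs_eq _ _ (Ne.symm hj), h1, h2]
        norm_num
      · exact absurd e (htri i j h1 h2)
      · rw [h.triangle hi (Ne.symm hj) hij (by omega) (by omega) (by omega), e]
        norm_num
    simp only [hA', Matrix.of_apply]
    rcases hsign i k with e1 | e1 | e1
    · rw [clusterMutate_of_nonpos hi hj (by simp [e1]), h.eq_zero hi e1]
      simpa using h.abs_eq i j hij
    · rcases hsign j k with e2 | e2 | e2
      · have e3 : B k j = 0 := by rw [hs j k, e2]; rfl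
        rw [clusterMutate_of_nonpos hi hj (by simp [e3]), h.eq_zero (Ne.symm hj) e3]
        simpa using h.abs_eq i j hij
      · rw [clusterMutate_of_nonpos hi hj (by rw [hs j k, e1, e2]; norm_num), ← h.abs_eq i j hij]
        simp only [hε, e1, e2, if_true]
        congr 1; ring
      · have e3 : B k j = 1 := by rw [hs j k, e2]; rfl
        rw [clusterMutate_of_pos hi hj e1 e3, ← main i j hij hi hj e1 e3]
        simp [hε, e1, e2]
    · rcases hsign j k with e2 | e2 | e2
      · have e3 : B k j = 0 := by rw [hs j k, e2]; rfl
        rw [clusterMutate_of_nonpos hi hj (by simp [e3]), h.eq_zero (Ne.symm hj) e3]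
        simpa using h.abs_eq i j hij
      · have e3 : B k j = -1 := by rw [hs j k, e2]
        have e4 : B k i = 1 := by rw [hs i k, e1]; rfl
        rw [clusterMutate_of_neg hi hj e1 e3]
        have := main j i (Ne.symm hij) hj hi e2 e4
        rw [hs i j, show -B i j + 1 = -(B i j - 1) by ring, abs_neg] at this
        rw [← this, h.symm j i, h.symm j k, h.symm k i]
        simp only [hε, e1, e2, if_true]
        norm_num
        rw [mul_comm]
      · rw [clusterMutate_of_nonpos hi hj (by rw [hs j k, e1, e2]; norm_num), ← h.abs_eq i j hij]
        simp [hε, e1, e2]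
  · intro x hx
    set c : ℤ := ∑ i, ε i * A i k * x i with hc
    have key : x ⬝ᵥ A'.mulVec x =
        (x + (-c) • Pi.single k 1) ⬝ᵥ A.mulVec (x + (-c) • Pi.single k 1) := by
      rw [h.norm_add_smul]
      have e1 : x ⬝ᵥ A.mulVec (Pi.single k 1) = ∑ i, A i k * x i := by
        simp [dotProduct, mul_comm]
      have e2 : (Pi.single k 1 : Fin n → ℤ) ⬝ᵥ A.mulVec (Pi.single k 1) = 2 := by simp [h.diag]
      rw [e1, e2]
      set d : ℤ := ∑ i, A i k * x i with hd
      have e3 : x ⬝ᵥ A'.mulVec x = x ⬝ᵥ A.mulVec x - (c * d + d * c) + 2 * (c * c) := by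
        rw [show c * d = ∑ i, ∑ j, _ from Finset.sum_mul_sum _ _ _ _,
          show d * c = ∑ i, ∑ j, _ from Finset.sum_mul_sum _ _ _ _,
          show c * c = ∑ i, ∑ j, _ from Finset.sum_mul_sum _ _ _ _]
        simp only [dotProduct, Matrix.mulVec, Finset.mul_sum,
          ← Finset.sum_add_distrib, ← Finset.sum_sub_distrib]
        refine Finset.sum_congr rfl fun i _ => Finset.sum_congr rfl fun j _ => ?_
        simp only [hA', Matrix.of_apply, h.symm k j]
        ring
      rw [e3]; ring
    rw [key]
    apply h.pos
    intro h0
    have hne : ∀ i, i ≠ k → x i = 0 := fun i hi => by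
      have := congrFun h0 i
      simpa [hi] using this
    have hc0 : c = 0 := Finset.sum_eq_zero fun i _ => by
      by_cases hi : i = k
      · simp [hi, εk]
      · simp [hne i hi]
    apply hx
    rw [hc0] at h0
    simpa using h0

theorem reflTransGen_of_seq {α : Type*} {R : α → α → Prop} (P : ℕ → α) {i j : ℕ} (hij : i ≤ j)
    (h : ∀ t, i ≤ t → t < j → R (P t) (P (t + 1))) : Relation.ReflTransGen R (P i) (P j) := by
  induction j, hij using Nat.le_induction with
  | base => exact .refl
  | succ j hij ih =>
    exact (ih fun t h1 h2 => h t h1 (by omega)).tail (h j hij (by omega))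

theorem reflTransGen_of_seq_reverse {α : Type*} {R : α → α → Prop} (P : ℕ → α) {i j : ℕ}
    (hij : i ≤ j) (h : ∀ t, i ≤ t → t < j → R (P (t + 1)) (P t)) :
    Relation.ReflTransGen R (P j) (P i) := by
  induction j, hij using Nat.le_induction with
  | base => exact .refl
  | succ j hij ih =>
    exact .head (h j hij (by omega)) (ih fun t h1 h2 => h t h1 (by omega))

theorem exists_seq_of_reflTransGen {α : Type*} {R : α → α → Prop} {a b : α}
    (h : Relation.ReflTransGen R a b) :
    ∃ (l : ℕ) (P : ℕ → α), P 0 = a ∧ P l = b ∧ ∀ t < l, R (P t) (P (t + 1)) := by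
  induction h with
  | refl => exact ⟨0, fun _ => a, rfl, rfl, fun t ht => absurd ht (by omega)⟩
  | @tail b c _ hbc ih =>
    obtain ⟨l, P, h0, hl, hR⟩ := ih
    refine ⟨l + 1, fun t => if t ≤ l then P t else c, by simp [h0], by simp, fun t ht => ?_⟩
    by_cases h' : t + 1 ≤ l
    · simpa [h', show t ≤ l by omega] using hR t (by omega)
    · obtain rfl : t = l := by omega
      simpa [hl] using hbc

/-- `b` is joined to `a` in the graph of `D` by a walk that avoids `s` and all neighbours of `s`
other than `a` and `b`. -/
def LinkAvoiding {n : ℕ} (D : Matrix (Fin n) (Fin n) ℤ) (s a b : Fin n) : Prop :=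
  Relation.ReflTransGen (fun x y => D x y ≠ 0 ∧ y ≠ s ∧ (D s y ≠ 0 → y = a ∨ y = b)) a b

/-- Some vertex `s` is a source or a sink of a cycle, all whose other vertices, except the two
neighbours of `s` on the cycle, are not adjacent to `s`. -/
def HasNonorientedCycle {n : ℕ} (D : Matrix (Fin n) (Fin n) ℤ) : Prop :=
  ∃ s a b, a ≠ b ∧ 0 < D s a * D s b ∧ LinkAvoiding D s a b

/-- The vertices `s, P 0, …, P l` form a chordless cycle in which `s` is a source or a sink. -/
structure IsDetour {n : ℕ} (D : Matrix (Fin n) (Fin n) ℤ) (s : Fin n) (P : ℕ → Fin n)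
    (l : ℕ) : Prop where
  pos : 0 < l
  adj : ∀ i j, i < j → j ≤ l → (D (P i) (P j) ≠ 0 ↔ j = i + 1)
  avoid : ∀ i ≤ l, P i ≠ s
  nbr : ∀ i ≤ l, D s (P i) ≠ 0 ↔ i = 0 ∨ i = l
  same : 0 < D s (P 0) * D s (P l)

theorem IsDetour.ne {n : ℕ} {D : Matrix (Fin n) (Fin n) ℤ} (hs : ∀ i j, D j i = -D i j)
    {s : Fin n} {P : ℕ → Fin n} {l : ℕ} (h : IsDetour D s P l) (hends : P 0 ≠ P l) :
    ∀ i j, i < j → j ≤ l → P i ≠ P j := by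
  intro i j hij hj e
  have h0 : D (P i) (P j) = 0 := by rw [e]; have := hs (P j) (P j); omega
  have h1 := h.adj i j hij hj
  rcases Nat.lt_or_ge j l with hjl | hjl
  · have h2 := (h.adj j (j + 1) (by omega) hjl).mpr rfl
    rw [← e] at h2
    have := (h.adj i (j + 1) (by omega) hjl).mp h2
    omega
  · obtain rfl : j = l := by omega
    rcases Nat.eq_zero_or_pos i with rfl | hi
    · exact hends e
    · have h2 := (h.adj (i - 1) i (by omega) (by omega)).mpr (by omega)
      rw [e] at h2
      have := (h.adj (i - 1) j (by omega) le_rfl).mp h2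
      omega

theorem LinkAvoiding.exists_isDetour {n : ℕ} {D : Matrix (Fin n) (Fin n) ℤ}
    (hs : ∀ i j, D j i = -D i j) {s a b : Fin n} (hab : a ≠ b) (hpos : 0 < D s a * D s b)
    (h : LinkAvoiding D s a b) : ∃ P l, IsDetour D s P l ∧ P 0 = a ∧ P l = b := by
  classical
  have hex := exists_seq_of_reflTransGen h
  obtain ⟨P, h0, hl, hR⟩ := Nat.find_spec hex
  have hmin := fun m (hm : m < Nat.find hex) => Nat.find_min hex hm
  generalize Nat.find hex = l at *
  have hss : D s s = 0 := by have := hs s s; omega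
  have hsa : D s a ≠ 0 := fun e => by simp [e] at hpos
  have hsb : D s b ≠ 0 := fun e => by simp [e] at hpos
  have hlpos : 0 < l := by
    rcases Nat.eq_zero_or_pos l with rfl | h'
    · exact absurd (h0.symm.trans hl) hab
    · exact h'
  have hav : ∀ i ≤ l, P i ≠ s := by
    intro i hi e
    rcases Nat.eq_zero_or_pos i with rfl | hi0
    · rw [h0] at e; rw [e] at hsa; exact hsa hss
    · obtain ⟨j, rfl⟩ : ∃ j, i = j + 1 := ⟨i - 1, by omega⟩
      exact (hR j (by omega)).2.1 e
  refine ⟨P, l, ⟨hlpos, ?_, hav, ?_, by rw [h0, hl]; exact hpos⟩, h0, hl⟩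
  · intro i j hij hj
    refine ⟨fun hne => ?_, fun e => e ▸ (hR i (by omega)).1⟩
    by_contra hc
    refine hmin (l - (j - i - 1)) (by omega)
      ⟨fun t => if t ≤ i then P t else P (t + (j - i - 1)), by simp [h0], ?_, fun t ht => ?_⟩
    · beta_reduce; rw [if_neg (by omega), ← hl]; congr 1; omega
    · rcases lt_trichotomy t i with h' | h' | h'
      · simpa [h'.le, show t + 1 ≤ i by omega] using hR t (by omega)
      · subst h'
        obtain ⟨j', rfl⟩ : ∃ j', j = j' + 1 := ⟨j - 1, by omega⟩
        have := hR j' (by omega)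
        simp only [le_refl, if_true, show ¬ t + 1 ≤ t by omega, if_false,
          show t + 1 + (j' + 1 - t - 1) = j' + 1 by omega]
        exact ⟨hne, this.2⟩
      · have := hR (t + (j - i - 1)) (by omega)
        simp only [show ¬ t ≤ i by omega, show ¬ t + 1 ≤ i by omega, if_false]
        rwa [show t + 1 + (j - i - 1) = t + (j - i - 1) + 1 by omega]
  · intro i hi
    refine ⟨fun hne => ?_, ?_⟩
    · by_contra hc
      push Not at hc
      obtain ⟨j, rfl⟩ : ∃ j, i = j + 1 := ⟨i - 1, by omega⟩
      rcases (hR j (by omega)).2.2 hne with e | e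
      · refine hmin (l - (j + 1)) (by omega) ⟨fun t => P (t + (j + 1)), by simpa using e, ?_,
          fun t ht => ?_⟩
        · simp only []; rw [← hl]; congr 1; omega
        · have := hR (t + (j + 1)) (by omega)
          rwa [show t + (j + 1) + 1 = t + 1 + (j + 1) by omega] at this
      · exact hmin (j + 1) (by omega) ⟨P, h0, e, fun t ht => hR t (by omega)⟩
    · rintro (rfl | rfl)
      · rwa [h0]
      · rwa [hl]

theorem LinkAvoiding.symm {n : ℕ} {D : Matrix (Fin n) (Fin n) ℤ}
    (hs : ∀ i j, D j i = -D i j) {s a b : Fin n} (hab : a ≠ b) (hpos : 0 < D s a * D s b)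
    (h : LinkAvoiding D s a b) : LinkAvoiding D s b a := by
  obtain ⟨P, l, hP, rfl, rfl⟩ := h.exists_isDetour hs hab hpos
  refine reflTransGen_of_seq_reverse P (Nat.zero_le l) fun t _ ht => ?_
  refine ⟨?_, hP.avoid t (by omega), fun hne => ?_⟩
  · rw [hs, neg_ne_zero]; exact (hP.adj t (t + 1) (by omega) (by omega)).mpr rfl
  · rcases (hP.nbr t (by omega)).mp hne with rfl | rfl
    · exact .inr rfl
    · exact .inl rfl

theorem HasNonorientedCycle.neg {n : ℕ} {D : Matrix (Fin n) (Fin n) ℤ}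
    (h : HasNonorientedCycle (-D)) : HasNonorientedCycle D := by
  obtain ⟨s, a, b, hab, hpos, hl⟩ := h
  exact ⟨s, a, b, hab, by simpa using hpos, by simpa [LinkAvoiding] using hl⟩

/-- The signs making consecutive basis vectors along a path have inner product `-1`. -/
def pathSign {n : ℕ} (A : Matrix (Fin n) (Fin n) ℤ) (P : ℕ → Fin n) : ℕ → ℤ
  | 0 => 1
  | t + 1 => -pathSign A P t * A (P t) (P (t + 1))

/-- The signed sum of the basis vectors along a segment of a path. -/
def pathSum {n : ℕ} (A : Matrix (Fin n) (Fin n) ℤ) (P : ℕ → Fin n) (i j : ℕ) : Fin n → ℤ :=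
  ∑ t ∈ Finset.Icc i j, pathSign A P t • Pi.single (P t) 1

theorem pathSum_inner {n : ℕ} (A : Matrix (Fin n) (Fin n) ℤ) (P : ℕ → Fin n) (i j : ℕ)
    (v : Fin n) : pathSum A P i j ⬝ᵥ A.mulVec (Pi.single v 1) =
      ∑ t ∈ Finset.Icc i j, pathSign A P t * A (P t) v := by
  simp only [pathSum, sum_dotProduct, smul_dotProduct, smul_eq_mul,
    IsPositiveCompanion.single_inner_single]

/-- `P 0, …, P l` is an induced path in the graph of `C`. -/
structure IsInducedPath {n : ℕ} (C : Matrix (Fin n) (Fin n) ℤ) (P : ℕ → Fin n) (l : ℕ) :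
    Prop where
  ne : ∀ i j, i < j → j ≤ l → P i ≠ P j
  adj : ∀ i j, i < j → j ≤ l → (C (P i) (P j) ≠ 0 ↔ j = i + 1)

theorem IsDetour.isInducedPath {n : ℕ} {D : Matrix (Fin n) (Fin n) ℤ}
    (hs : ∀ i j, D j i = -D i j) {s : Fin n} {P : ℕ → Fin n} {l : ℕ} (h : IsDetour D s P l)
    (hends : P 0 ≠ P l) : IsInducedPath D P l :=
  ⟨h.ne hs hends, h.adj⟩

namespace IsPositiveCompanion

variable {n : ℕ} {A C : Matrix (Fin n) (Fin n) ℤ} {P : ℕ → Fin n} {l : ℕ}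

theorem pathSign_sq (h : IsPositiveCompanion A C) (hP : IsInducedPath C P l) :
    ∀ t ≤ l, pathSign A P t ^ 2 = 1
  | 0, _ => by simp [pathSign]
  | t + 1, ht => by
    have h1 := h.sq_eq_one (hP.ne t (t + 1) (by omega) ht)
      ((hP.adj t (t + 1) (by omega) ht).mpr rfl)
    rw [pathSign, mul_pow, neg_sq, pathSign_sq h hP t (by omega), h1, one_mul]

theorem pathSum_apply (h : IsPositiveCompanion A C) (hP : IsInducedPath C P l) {i j : ℕ}
    (hij : i ≤ j) (hj : j ≤ l) : pathSum A P i j (P i) ≠ 0 := by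
  have h0 : pathSign A P i ≠ 0 := fun e => by simpa [e] using h.pathSign_sq hP i (by omega)
  rw [pathSum, Finset.sum_apply, Finset.sum_eq_single i]
  · simpa using h0
  · intro t ht hti
    rw [Finset.mem_Icc] at ht
    simp [hP.ne i t (by omega) (by omega)]
  · intro hi
    exact absurd (Finset.mem_Icc.mpr ⟨le_rfl, hij⟩) hi

theorem pathSum_norm (h : IsPositiveCompanion A C) (hP : IsInducedPath C P l) {i j : ℕ}
    (hij : i ≤ j) (hj : j ≤ l) : pathSum A P i j ⬝ᵥ A.mulVec (pathSum A P i j) = 2 := by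
  induction j, hij using Nat.le_induction with
  | base =>
    have h1 := h.pathSign_sq hP i hj
    have : pathSum A P i i = 0 + pathSign A P i • Pi.single (P i) 1 := by simp [pathSum]
    rw [this, h.norm_add_smul, single_inner_single, h.diag, h1]
    simp
  | succ j hij ih =>
    have e : pathSum A P i (j + 1) =
        pathSum A P i j + pathSign A P (j + 1) • Pi.single (P (j + 1)) 1 := by
      rw [pathSum, ← Finset.insert_Icc_right_eq_Icc_add_one (by omega), Finset.sum_insert (by simp),
        add_comm, pathSum]
    have e2 : pathSum A P i j ⬝ᵥ A.mulVec (Pi.single (P (j + 1)) 1) = -pathSign A P (j + 1) := by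
      rw [pathSum_inner, Finset.sum_eq_single j]
      · rw [pathSign]; ring
      · intro t ht htj
        rw [Finset.mem_Icc] at ht
        rw [h.eq_zero (hP.ne t (j + 1) (by omega) hj), mul_zero]
        by_contra hc
        have := (hP.adj t (j + 1) (by omega) hj).mp hc
        omega
      · intro hi
        exact absurd (Finset.mem_Icc.mpr ⟨hij, le_rfl⟩) hi
    have h1 := h.pathSign_sq hP (j + 1) hj
    rw [e, h.norm_add_smul, ih (by omega), e2, single_inner_single, h.diag]
    linear_combination (-2 + 2) * h1

theorem pathSum_inner_eq (h : IsPositiveCompanion A C) {i j t : ℕ} {v : Fin n}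
    (hv : ∀ t, i ≤ t → t ≤ j → P t ≠ v) (hit : i ≤ t) (htj : t ≤ j)
    (hC : ∀ r, i ≤ r → r ≤ j → C (P r) v ≠ 0 → r = t) :
    pathSum A P i j ⬝ᵥ A.mulVec (Pi.single v 1) = pathSign A P t * A (P t) v := by
  rw [pathSum_inner, Finset.sum_eq_single t]
  · intro r hr hrt
    rw [Finset.mem_Icc] at hr
    rw [h.eq_zero (hv r hr.1 hr.2), mul_zero]
    by_contra hc
    exact hrt (hC r hr.1 hr.2 hc)
  · intro hi
    exact absurd (Finset.mem_Icc.mpr ⟨hit, htj⟩) hi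

theorem pathSign_mul_sq (h : IsPositiveCompanion A C) (hP : IsInducedPath C P l) {t : ℕ}
    (ht : t ≤ l) {v : Fin n} (hv : P t ≠ v) (hC : C (P t) v ≠ 0) :
    (pathSign A P t * A (P t) v) ^ 2 = 1 := by
  rw [mul_pow, h.pathSign_sq hP t ht, h.sq_eq_one hv hC, one_mul]

/-- If a vertex has exactly two neighbours on an induced path, at its ends, then its signed
inner products with these cancel. -/
theorem pathSign_add_eq_zero (h : IsPositiveCompanion A C) (hP : IsInducedPath C P l) {i j : ℕ}
    (hij : i < j) (hj : j ≤ l) {v : Fin n} (hv : ∀ t ≤ l, P t ≠ v) (hi : C (P i) v ≠ 0)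
    (hj' : C (P j) v ≠ 0) (hC : ∀ t, i < t → t < j → C (P t) v = 0) :
    pathSign A P i * A (P i) v + pathSign A P j * A (P j) v = 0 := by
  have e : pathSum A P i j ⬝ᵥ A.mulVec (Pi.single v 1) =
      pathSign A P i * A (P i) v + pathSign A P j * A (P j) v := by
    rw [pathSum_inner, Finset.sum_eq_add_of_mem i j (by simp; omega) (by simp; omega) hij.ne]
    intro t ht hne
    rw [Finset.mem_Icc] at ht
    rw [h.eq_zero (hv t (by omega)) (hC t (by omega) (by omega)), mul_zero]
  have hz : (Pi.single v 1 : Fin n → ℤ) (P i) = 0 := by simp [hv i (by omega)]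
  have hnz := h.pathSum_apply hP hij.le hj
  have h1 := h.abs_inner_le_one (x := pathSum A P i j) (y := Pi.single v 1)
    (h.pathSum_norm hP hij.le hj) (by rw [single_inner_single, h.diag])
    (fun e => hnz (by rw [e, hz])) (fun e => hnz (by rw [e, Pi.neg_apply, hz, neg_zero]))
  have h2 := h.pathSign_mul_sq hP (by omega) (hv i (by omega)) hi
  have h3 := h.pathSign_mul_sq hP (by omega) (hv j (by omega)) hj'
  rw [e, abs_le] at h1
  rw [sq_eq_one_iff] at h2 h3
  omega

/-- The sign rule for a triangle formed by a segment of an induced path and two vertices. -/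
theorem pathSign_triangle (h : IsPositiveCompanion A C) (hP : IsInducedPath C P l) {i j a b : ℕ}
    (hij : i ≤ j) (hj : j ≤ l) {v w : Fin n} (hv : ∀ t ≤ l, P t ≠ v) (hw : ∀ t ≤ l, P t ≠ w)
    (ha : i ≤ a ∧ a ≤ j) (hb : i ≤ b ∧ b ≤ j) (hvw : v ≠ w) (hCvw : C v w ≠ 0)
    (hCa : C (P a) v ≠ 0) (hCb : C (P b) w ≠ 0)
    (hCv : ∀ r, i ≤ r → r ≤ j → C (P r) v ≠ 0 → r = a)
    (hCw : ∀ r, i ≤ r → r ≤ j → C (P r) w ≠ 0 → r = b) :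
    (pathSign A P a * A (P a) v) * A v w * (pathSign A P b * A (P b) w) = 1 := by
  have s1 := h.pathSign_mul_sq hP (by omega) (hv a (by omega)) hCa
  have s2 := h.pathSign_mul_sq hP (by omega) (hw b (by omega)) hCb
  have s3 := h.sq_eq_one hvw hCvw
  have key := h.inner_mul_inner_mul_inner (x := pathSum A P i j) (y := Pi.single v 1)
    (z := Pi.single w 1) (h.pathSum_norm hP hij hj) (by simp [h.diag]) (by simp [h.diag])
    (h.pathSum_inner_eq (fun t _ ht => hv t (by omega)) ha.1 ha.2 hCv)
    (single_inner_single A v w)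
    (h.pathSum_inner_eq (fun t _ ht => hw t (by omega)) hb.1 hb.2 hCw) s1 s2 (by
      intro e
      have := congrFun e (P i)
      simp [hv i (by omega), hw i (by omega)] at this
      exact h.pathSum_apply hP hij hj this)
  generalize pathSign A P a * A (P a) v = x at *
  generalize pathSign A P b * A (P b) w = y at *
  rw [sq_eq_one_iff] at s1 s2 s3
  rcases s1 with e1 | e1 <;> rcases s2 with e2 | e2 <;> rcases s3 with e3 | e3 <;>
    rw [e1, e2, e3] at key ⊢ <;> omega

end IsPositiveCompanion

section Mutation

variable {n : ℕ} {A C : Matrix (Fin n) (Fin n) ℤ} {s k : Fin n} {P : ℕ → Fin n} {l : ℕ}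

theorem clusterMutate_of_eq_zero_left {i j : Fin n} (hi : i ≠ k) (hj : j ≠ k) (h : C i k = 0) :
    clusterMutate C k i j = C i j :=
  clusterMutate_of_nonpos hi hj (by simp [h])

theorem clusterMutate_of_eq_zero_right {i j : Fin n} (hi : i ≠ k) (hj : j ≠ k) (h : C k j = 0) :
    clusterMutate C k i j = C i j :=
  clusterMutate_of_nonpos hi hj (by simp [h])

/-- Mutation at a vertex that is a source or a sink of a cycle. -/
theorem hasNonorientedCycle_clusterMutate_center (hs : ∀ i j, C j i = -C i j) {a b : Fin n}
    (hab : a ≠ b) (hpos : 0 < C k a * C k b) (hl : LinkAvoiding C k a b) :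
    HasNonorientedCycle (clusterMutate C k) := by
  obtain ⟨P, l, h, rfl, rfl⟩ := hl.exists_isDetour hs hab hpos
  refine ⟨k, P 0, P l, hab, by simpa [clusterMutate_left] using hpos,
    reflTransGen_of_seq P (Nat.zero_le l) fun t _ ht => ⟨?_, h.avoid _ (by omega), fun hne => ?_⟩⟩
  · rw [clusterMutate_of_nonpos (h.avoid _ (by omega)) (h.avoid _ (by omega))]
    · exact (h.adj t (t + 1) (by omega) ht).mpr rfl
    · rw [hs k]
      by_cases h1 : C k (P t) = 0
      · simp [h1]
      by_cases h2 : C k (P (t + 1)) = 0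
      · simp [h2]
      have h1' := (h.nbr t (by omega)).mp h1
      have h2' := (h.nbr (t + 1) (by omega)).mp h2
      obtain rfl : t = 0 := by omega
      obtain rfl : l = 1 := by omega
      simpa using hpos.le
  · rw [clusterMutate_left, neg_ne_zero, h.nbr _ (by omega)] at hne
    rcases hne with e | e
    · omega
    · right; rw [e]

/-- Mutation at a vertex not adjacent to the source or sink of a cycle. -/
theorem hasNonorientedCycle_clusterMutate_of_eq_zero (hs : ∀ i j, C j i = -C i j)
    {a b : Fin n} (hks : k ≠ s) (h0 : C k s = 0) (hab : a ≠ b) (hpos : 0 < C s a * C s b)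
    (hl : LinkAvoiding C s a b) : HasNonorientedCycle (clusterMutate C k) := by
  have h0' : C s k = 0 := by rw [hs k, h0, neg_zero]
  have hD : ∀ x, clusterMutate C k s x = C s x := by
    intro x
    by_cases hx : x = k
    · subst hx; simp [clusterMutate_right, h0']
    · exact clusterMutate_of_eq_zero_left hks.symm hx h0'
  refine ⟨s, a, b, hab, by rwa [hD, hD], hl.lift' id fun x y ⟨h1, h2, h3⟩ => ?_⟩
  by_cases hxy : clusterMutate C k x y = 0
  · have hx : x ≠ k := by
      rintro rfl; rw [clusterMutate_left, neg_eq_zero] at hxy; exact h1 hxy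
    have hy : y ≠ k := by
      rintro rfl; rw [clusterMutate_right, neg_eq_zero] at hxy; exact h1 hxy
    have hxk : C x k ≠ 0 := fun e => h1 (by rwa [clusterMutate_of_eq_zero_left hx hy e] at hxy)
    have hky : C k y ≠ 0 := fun e => h1 (by rwa [clusterMutate_of_eq_zero_right hx hy e] at hxy)
    refine .tail (.single (b := k) ⟨?_, hks, fun h => ?_⟩) ⟨?_, h2, fun h => h3 ?_⟩
    · simpa [clusterMutate_right] using hxk
    · exact absurd h0' (by rwa [hD] at h)
    · simpa [clusterMutate_left] using hky
    · rwa [hD] at h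
  · exact .single ⟨hxy, h2, fun h => h3 (by rwa [hD] at h)⟩

/-- Mutation at a neighbour of the source of a cycle. -/
theorem hasNonorientedCycle_clusterMutate_endpoint (hs : ∀ i j, C j i = -C i j)
    (hC : IsSignMatrix C) (hD : IsSignMatrix (clusterMutate C k)) {b : Fin n} (hkb : k ≠ b)
    (hk : C s k = 1) (hb : C s b = 1) (hl : LinkAvoiding C s k b) :
    HasNonorientedCycle (clusterMutate C k) := by
  obtain ⟨P, l, h, rfl, rfl⟩ := hl.exists_isDetour hs hkb (by simp [hk, hb])
  have hne := h.ne hs hkb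
  have hsk : s ≠ P 0 := (h.avoid 0 (by omega)).symm
  have hPk : ∀ t, 0 < t → t ≤ l → P t ≠ P 0 := fun t h1 h2 => (hne 0 t h1 h2).symm
  have hl0 := h.pos
  have h2k : ∀ t, 2 ≤ t → t ≤ l → C (P 0) (P t) = 0 := fun t h1 h2 => by
    by_contra hc
    have := (h.adj 0 t (by omega) h2).mp hc
    omega
  have h1k : C (P 0) (P 1) ≠ 0 := (h.adj 0 1 (by omega) (by omega)).mpr rfl
  rcases (hC (P 0) (P 1)).resolve_left h1k with h1 | h1
  · have hs1 := clusterMutate_of_pos hsk (hPk 1 (by omega) (by omega)) hk h1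
    rcases Nat.lt_or_ge l 2 with hl2 | hl2
    · obtain rfl : l = 1 := by omega
      have := hD s (P 1)
      omega
    · have hsl : clusterMutate C (P 0) s (P l) = C s (P l) :=
        clusterMutate_of_eq_zero_right hsk (hPk l (by omega) le_rfl) (h2k l hl2 le_rfl)
      have hs0 : C s (P 1) = 0 := by
        by_contra hc
        have := (h.nbr 1 (by omega)).mp hc
        omega
      refine ⟨s, P 1, P l, hne 1 l (by omega) le_rfl, by simp [hs1, hsl, hb, hs0],
        reflTransGen_of_seq P (by omega) fun t ht1 ht => ⟨?_, h.avoid _ (by omega), fun h3 => ?_⟩⟩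
      · rw [clusterMutate_of_eq_zero_right (hPk t (by omega) (by omega))
          (hPk _ (by omega) (by omega)) (h2k _ (by omega) (by omega))]
        exact (h.adj t (t + 1) (by omega) ht).mpr rfl
      · rw [clusterMutate_of_eq_zero_right hsk (hPk _ (by omega) (by omega))
          (h2k _ (by omega) (by omega)), h.nbr _ (by omega)] at h3
        right; congr 1; omega
  · refine ⟨P 0, s, P 1, (h.avoid 1 (by omega)).symm, ?_, .head (b := P l) ⟨?_, ?_, ?_⟩
      (reflTransGen_of_seq_reverse P (i := 1) (by omega) fun t ht1 ht => ⟨?_, ?_, fun h3 => ?_⟩)⟩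
    · rw [clusterMutate_left, clusterMutate_left, h1, hs s, hk]; norm_num
    · rw [clusterMutate_of_nonpos hsk (hPk l (by omega) le_rfl), hb]
      · norm_num
      · rw [hk]
        rcases Nat.lt_or_ge l 2 with hl2 | hl2
        · obtain rfl : l = 1 := by omega
          rw [h1]; norm_num
        · rw [h2k l hl2 le_rfl]; norm_num
    · exact hPk l (by omega) le_rfl
    · intro h3
      rw [clusterMutate_left, neg_ne_zero] at h3
      right; congr 1
      by_contra hc
      exact h3 (h2k l (by omega) le_rfl)
    · rw [clusterMutate_of_eq_zero_left (hPk _ (by omega) (by omega))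
        (hPk _ (by omega) (by omega)) (by rw [hs, h2k _ (by omega) (by omega), neg_zero]), hs,
        neg_ne_zero]
      exact (h.adj t (t + 1) (by omega) ht).mpr rfl
    · exact hPk t (by omega) (by omega)
    · rw [clusterMutate_left, neg_ne_zero] at h3
      right; congr 1
      by_contra hc
      exact h3 (h2k t (by omega) (by omega))

end Mutation

section Invariance

variable {n : ℕ} {A C : Matrix (Fin n) (Fin n) ℤ} {s k : Fin n} {P : ℕ → Fin n} {l : ℕ}

theorem IsPositiveCompanion.mul_pathSign_eq (h : IsPositiveCompanion A C)
    (hs : ∀ i j, C j i = -C i j) (hP : IsInducedPath C P l) {v : Fin n}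
    (hv : ∀ t ≤ l, P t ≠ v)
    (halt : ∀ i j, i < j → j ≤ l → C v (P i) ≠ 0 → C v (P j) ≠ 0 →
      (∀ t, i < t → t < j → C v (P t) = 0) → C v (P i) = -C v (P j)) (d : ℕ) :
    ∀ i, i + d ≤ l → C v (P i) ≠ 0 → C v (P (i + d)) ≠ 0 →
      C v (P i) * (pathSign A P i * A (P i) v) =
        C v (P (i + d)) * (pathSign A P (i + d) * A (P (i + d)) v) := by
  have hsw : ∀ x y, C x y = 0 ↔ C y x = 0 := fun x y => by rw [hs x y, neg_eq_zero]
  induction d using Nat.strong_induction_on with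
  | _ d ih =>
    intro i hl hi hd
    rcases Nat.eq_zero_or_pos d with rfl | hd0
    · rfl
    by_cases hmid : ∃ t, i < t ∧ t < i + d ∧ C v (P t) ≠ 0
    · obtain ⟨t, h1, h2, h3⟩ := hmid
      have e1 := ih (t - i) (by omega) i (by omega) hi (by rwa [show i + (t - i) = t by omega])
      have e2 := ih (i + d - t) (by omega) t (by omega) h3
        (by rwa [show t + (i + d - t) = i + d by omega])
      rw [show i + (t - i) = t by omega] at e1
      rw [show t + (i + d - t) = i + d by omega] at e2
      rw [e1, e2]
    · push Not at hmid
      have e1 := halt i (i + d) (by omega) hl hi hd hmid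
      have e2 := h.pathSign_add_eq_zero hP (i := i) (j := i + d) (by omega) hl hv
        (by rwa [Ne, hsw]) (by rwa [Ne, hsw]) fun t h1 h2 => by rw [hsw]; exact hmid t h1 h2
      rw [e1]
      linear_combination (-C v (P (i + d))) * e2

/-- Mutation at a neighbour of the source of a cycle, not on this cycle. -/
theorem IsDetour.hasNonorientedCycle_clusterMutate (h : IsDetour C s P l)
    (hA : IsPositiveCompanion A C) (hs : ∀ i j, C j i = -C i j)
    (hD : IsSignMatrix (clusterMutate C k)) (hends : P 0 ≠ P l) (h0 : C s (P 0) = 1)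
    (hl : C s (P l) = 1) (hks : C s k ≠ 0) (hk0 : k ≠ P 0) (hkl : k ≠ P l) :
    HasNonorientedCycle (clusterMutate C k) := by
  have hC := hA.isSignMatrix hs
  have hP := h.isInducedPath hs hends
  have hlpos := h.pos
  have hsw : ∀ x y, C x y = 0 ↔ C y x = 0 := fun x y => by rw [hs x y, neg_eq_zero]
  have hsk : s ≠ k := by
    rintro rfl
    have := hs s s
    omega
  have hPk : ∀ t ≤ l, P t ≠ k := by
    rintro t ht rfl
    rcases (h.nbr t ht).mp hks with rfl | rfl
    · exact hk0 rfl
    · exact hkl rfl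
  have hadj : ∀ t < l, C (P t) (P (t + 1)) ≠ 0 := fun t ht =>
    (h.adj t (t + 1) (by omega) ht).mpr rfl
  have hadj' : ∀ t < l, C (P (t + 1)) (P t) ≠ 0 := fun t ht => by
    rw [Ne, hsw]; exact hadj t ht
  by_cases hnone : ∀ t ≤ l, C k (P t) = 0
  · have hDs : ∀ t ≤ l, clusterMutate C k s (P t) = C s (P t) := fun t ht =>
      clusterMutate_of_eq_zero_right hsk (hPk t ht) (hnone t ht)
    refine ⟨s, P 0, P l, hends, by simp [hDs 0 (by omega), hDs l le_rfl, h0, hl],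
      reflTransGen_of_seq P (Nat.zero_le l) fun t _ ht => ⟨?_, h.avoid _ (by omega), fun h3 => ?_⟩⟩
    · rw [clusterMutate_of_eq_zero_right (hPk _ (by omega)) (hPk _ (by omega)) (hnone _ (by omega))]
      exact hadj t ht
    · rw [hDs _ (by omega), h.nbr _ (by omega)] at h3
      right; congr 1; omega
  push Not at hnone
  rcases (hC s k).resolve_left hks with h1 | h1
  · obtain ⟨y, hy, hky⟩ := hnone
    rcases Nat.lt_or_ge y l with hyl | hyl
    · refine hasNonorientedCycle_clusterMutate_endpoint hs hC hD hk0 h1 h0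
        (.head (b := P y) ⟨hky, h.avoid y hy, fun h3 => ?_⟩
          (reflTransGen_of_seq_reverse P (Nat.zero_le y) fun t _ ht =>
            ⟨hadj' t (by omega), h.avoid t (by omega), fun h3 => ?_⟩))
      · rw [h.nbr _ hy] at h3
        right; congr 1; omega
      · rw [h.nbr _ (by omega)] at h3
        right; congr 1; omega
    · obtain rfl : y = l := by omega
      exact hasNonorientedCycle_clusterMutate_endpoint hs hC hD hkl h1 hl
        (.single ⟨hky, h.avoid y hy, fun _ => .inr rfl⟩)
  · by_contra hbad
    have hks1 : C k s = 1 := by rw [hs s, h1]; norm_num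
    have center : ∀ a b, a ≠ b → 0 < C k a * C k b → ¬ LinkAvoiding C k a b :=
      fun a b hab hpos hlink => hbad (hasNonorientedCycle_clusterMutate_center hs hab hpos hlink)
    have halt : ∀ i j, i < j → j ≤ l → C k (P i) ≠ 0 → C k (P j) ≠ 0 →
        (∀ t, i < t → t < j → C k (P t) = 0) → C k (P i) = -C k (P j) := by
      intro i j hij hj hi hj' hmid
      by_contra hc
      refine center (P i) (P j) (hP.ne i j hij hj) ?_ (reflTransGen_of_seq P hij.le fun t ht1 ht =>
        ⟨hadj t (by omega), hPk _ (by omega), fun h3 => ?_⟩)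
      · rcases (hC k (P i)).resolve_left hi with e | e <;>
          rcases (hC k (P j)).resolve_left hj' with e' | e' <;> rw [e, e'] at hc ⊢ <;> norm_num at *
      · right; congr 1
        by_contra hne
        exact h3 (hmid _ (by omega) (by omega))
    have hfirst : ∀ y ≤ l, C k (P y) ≠ 0 → (∀ t < y, C k (P t) = 0) → C k (P y) = -1 := by
      intro y hy hky hbefore
      by_contra hc
      have e : C k (P y) = 1 := ((hC k (P y)).resolve_left hky).resolve_right hc
      refine center s (P y) (h.avoid y hy).symm (by rw [hks1, e]; norm_num)
        (.head (b := P 0) ⟨by rw [h0]; norm_num, hPk 0 (by omega), fun h3 => ?_⟩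
          (reflTransGen_of_seq P (Nat.zero_le y) fun t _ ht =>
            ⟨hadj t (by omega), hPk _ (by omega), fun h3 => ?_⟩))
      · right; congr 1
        by_contra hne
        exact h3 (hbefore 0 (by omega))
      · right; congr 1
        by_contra hne
        exact h3 (hbefore _ (by omega))
    have hlast : ∀ y ≤ l, C k (P y) ≠ 0 → (∀ t, y < t → t ≤ l → C k (P t) = 0) →
        C k (P y) = -1 := by
      intro y hy hky hafter
      by_contra hc
      have e : C k (P y) = 1 := ((hC k (P y)).resolve_left hky).resolve_right hc
      refine center s (P y) (h.avoid y hy).symm (by rw [hks1, e]; norm_num)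
        (.head (b := P l) ⟨by rw [hl]; norm_num, hPk l le_rfl, fun h3 => ?_⟩
          (reflTransGen_of_seq_reverse P hy fun t hty ht =>
            ⟨hadj' t (by omega), hPk _ (by omega), fun h3 => ?_⟩))
      · right; congr 1
        by_contra hne
        exact h3 (hafter l (by omega) le_rfl)
      · right; congr 1
        by_contra hne
        exact h3 (hafter t (by omega) (by omega))
    classical
    obtain ⟨y, ⟨hy, hky⟩, hbefore⟩ : ∃ y, (y ≤ l ∧ C k (P y) ≠ 0) ∧ ∀ t < y, C k (P t) = 0 := by
      refine ⟨Nat.find hnone, Nat.find_spec hnone, fun t ht => ?_⟩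
      by_contra hc
      exact Nat.find_min hnone ht ⟨by have := (Nat.find_spec hnone).1; omega, hc⟩
    obtain ⟨z, ⟨hz, hkz⟩, hafter⟩ :
        ∃ z, (z ≤ l ∧ C k (P z) ≠ 0) ∧ ∀ t, z < t → t ≤ l → C k (P t) = 0 := by
      obtain ⟨w, hw, hkw⟩ := hnone
      have hspec := Nat.findGreatest_spec (P := fun t => C k (P t) ≠ 0) hw hkw
      refine ⟨_, ⟨Nat.findGreatest_le l, hspec⟩, fun t ht htl => ?_⟩
      by_contra hc
      exact Nat.findGreatest_is_greatest ht htl hc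
    have hy1 := hfirst y hy hky hbefore
    have hz1 := hlast z hz hkz hafter
    have hyz : y ≤ z := by
      by_contra hc
      exact hky (hafter y (by omega) hy)
    rcases Nat.eq_zero_or_pos z with rfl | hz0
    · obtain rfl : y = 0 := by omega
      have hDs : ∀ t, 0 < t → t ≤ l → clusterMutate C k s (P t) = C s (P t) := fun t ht0 ht =>
        clusterMutate_of_eq_zero_right hsk (hPk t ht) (hafter t ht0 ht)
      refine hbad ⟨s, k, P l, hkl, ?_, .head (b := P 0) ⟨?_, h.avoid 0 (by omega), fun h3 => ?_⟩
        (reflTransGen_of_seq P (Nat.zero_le l) fun t _ ht =>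
          ⟨?_, h.avoid _ (by omega), fun h3 => ?_⟩)⟩
      · rw [clusterMutate_right, hDs l hlpos le_rfl, h1, hl]; norm_num
      · rw [clusterMutate_left, neg_ne_zero]; exact hky
      · rw [clusterMutate_of_neg hsk (hPk 0 (by omega)) h1 hy1, h0] at h3
        exact absurd rfl h3
      · rw [clusterMutate_of_eq_zero_right (hPk _ (by omega)) (hPk _ (by omega))
          (hafter _ (by omega) (by omega))]
        exact hadj t ht
      · rw [hDs _ (by omega) (by omega), h.nbr _ (by omega)] at h3
        right; congr 1; omega
    rcases Nat.lt_or_ge y l with hyl | hyl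
    · have e1 := hA.pathSign_triangle hP (i := 0) (j := y) (a := 0) (b := y) (Nat.zero_le y) hy
        h.avoid hPk (by omega) (by omega) hsk hks (by rw [Ne, hsw, h0]; norm_num)
        (by rwa [Ne, hsw]) (fun r _ hr hC => by
          rw [Ne, hsw, ← Ne, h.nbr r (by omega)] at hC; omega)
        (fun r _ hr hC => by
          by_contra hne
          rw [Ne, hsw] at hC
          exact hC (hbefore r (by omega)))
      have e2 := hA.pathSign_triangle hP (i := z) (j := l) (a := l) (b := z) hz le_rfl
        h.avoid hPk (by omega) (by omega) hsk hks (by rw [Ne, hsw, hl]; norm_num)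
        (by rwa [Ne, hsw]) (fun r _ hr hC => by
          rw [Ne, hsw, ← Ne, h.nbr r (by omega)] at hC; omega)
        (fun r _ hr hC => by
          by_contra hne
          rw [Ne, hsw] at hC
          exact hC (hafter r (by omega) (by omega)))
      have e3 := hA.mul_pathSign_eq hs hP hPk halt (z - y) y (by omega) hky
        (by rwa [show y + (z - y) = z by omega])
      have e4 := hA.pathSign_add_eq_zero hP (i := 0) (j := l) hlpos le_rfl h.avoid
        (by rw [Ne, hsw, h0]; norm_num) (by rw [Ne, hsw, hl]; norm_num) fun t ht0 htl => by
          rw [hsw]; by_contra hc; rw [← Ne, h.nbr t (by omega)] at hc; omega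
      rw [show y + (z - y) = z by omega, hy1, hz1] at e3
      have e5 : pathSign A P y * A (P y) k = pathSign A P z * A (P z) k := by linarith
      rw [e5] at e1
      generalize pathSign A P z * A (P z) k = c at *
      have : (pathSign A P 0 * A (P 0) s + pathSign A P l * A (P l) s) * A s k * c = 2 := by
        linear_combination e1 + e2
      rw [e4] at this
      norm_num at this
    · obtain rfl : y = l := by omega
      have hDs : ∀ t < y, clusterMutate C k s (P t) = C s (P t) := fun t ht =>
        clusterMutate_of_eq_zero_right hsk (hPk t (by omega)) (hbefore t ht)
      refine hbad ⟨s, k, P 0, hk0, ?_, .head (b := P y) ⟨?_, h.avoid y le_rfl, fun h3 => ?_⟩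
        (reflTransGen_of_seq_reverse P (Nat.zero_le y) fun t _ ht =>
          ⟨?_, h.avoid _ (by omega), fun h3 => ?_⟩)⟩
      · rw [clusterMutate_right, hDs 0 hlpos, h1, h0]; norm_num
      · rw [clusterMutate_left, neg_ne_zero]; exact hky
      · rw [clusterMutate_of_neg hsk (hPk y le_rfl) h1 hy1, hl] at h3
        exact absurd rfl h3
      · rw [clusterMutate_of_eq_zero_right (hPk _ (by omega)) (hPk _ (by omega))
          (hbefore _ (by omega))]
        exact hadj' t ht
      · rw [hDs _ (by omega), h.nbr _ (by omega)] at h3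
        right; congr 1; omega

theorem IsPositiveCompanion.neg (h : IsPositiveCompanion A C) : IsPositiveCompanion A (-C) :=
  ⟨h.symm, h.diag, fun i j hij => by simpa using h.abs_eq i j hij, h.pos⟩

theorem HasNonorientedCycle.clusterMutate_of_one (hA : IsPositiveCompanion A C)
    (hs : ∀ i j, C j i = -C i j) (hD : IsSignMatrix (clusterMutate C k)) {a b : Fin n}
    (hab : a ≠ b) (ha : C s a = 1) (hb : C s b = 1) (hl : LinkAvoiding C s a b) :
    HasNonorientedCycle (clusterMutate C k) := by
  have hC := hA.isSignMatrix hs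
  have hpos : 0 < C s a * C s b := by rw [ha, hb]; norm_num
  by_cases hks : k = s
  · subst hks
    exact hasNonorientedCycle_clusterMutate_center hs hab hpos hl
  by_cases hk0 : C s k = 0
  · exact hasNonorientedCycle_clusterMutate_of_eq_zero hs hks (by rw [hs, hk0, neg_zero]) hab hpos hl
  by_cases hka : k = a
  · subst hka
    exact hasNonorientedCycle_clusterMutate_endpoint hs hC hD hab ha hb hl
  by_cases hkb : k = b
  · subst hkb
    exact hasNonorientedCycle_clusterMutate_endpoint hs hC hD hab.symm hb ha (hl.symm hs hab hpos)
  obtain ⟨P, l, h, rfl, rfl⟩ := hl.exists_isDetour hs hab hpos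
  exact h.hasNonorientedCycle_clusterMutate hA hs hD hab ha hb hk0 hka hkb

theorem HasNonorientedCycle.clusterMutate (h : HasNonorientedCycle C)
    (hA : IsPositiveCompanion A C) (hs : ∀ i j, C j i = -C i j)
    (hD : IsSignMatrix (clusterMutate C k)) : HasNonorientedCycle (clusterMutate C k) := by
  obtain ⟨s, a, b, hab, hpos, hl⟩ := h
  have hC := hA.isSignMatrix hs
  rcases hC s a with ha | ha | ha <;> rcases hC s b with hb | hb | hb <;> rw [ha, hb] at hpos <;>
    norm_num at hpos
  · exact .clusterMutate_of_one hA hs hD hab ha hb hl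
  · refine .neg ?_
    rw [← clusterMutate_neg hC]
    refine .clusterMutate_of_one (s := s) hA.neg (fun i j => by simp [hs i j]) ?_ hab (by simp [ha])
      (by simp [hb]) (by simpa [LinkAvoiding] using hl)
    rw [clusterMutate_neg hC]
    intro i j
    have := hD i j
    simp only [Matrix.neg_apply]
    omega

/-- A skew-symmetric matrix with a positive definite companion all of whose cycles are oriented. -/
structure IsGoodMatrix (C : Matrix (Fin n) (Fin n) ℤ) : Prop where
  skew : ∀ i j, C j i = -C i j
  exists_companion : ∃ A, IsPositiveCompanion A C
  oriented : ¬ HasNonorientedCycle C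

theorem IsGoodMatrix.clusterMutate (h : IsGoodMatrix C) (k : Fin n) :
    IsGoodMatrix (clusterMutate C k) := by
  obtain ⟨A, hA⟩ := h.exists_companion
  have hC := hA.isSignMatrix h.skew
  have hsk := clusterMutate_skew hC h.skew k
  have htri : ∀ i j, C i k = 1 → C k j = 1 → C i j ≠ 1 := fun i j hik hkj hij => by
    refine h.oriented ⟨i, k, j, ?_, by rw [hik, hij]; norm_num,
      .single ⟨by rw [hkj]; norm_num, ?_, fun _ => .inr rfl⟩⟩
    · rintro rfl
      have := h.skew k k
      omega
    · rintro rfl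
      have := h.skew j j
      omega
  obtain ⟨A', hA'⟩ := hA.exists_clusterMutate h.skew k htri
  refine ⟨fun i j => hsk i j, ⟨A', hA'⟩, fun hbad => h.oriented ?_⟩
  have := hbad.clusterMutate (k := k) hA' hsk (by rwa [clusterMutate_clusterMutate hC])
  rwa [clusterMutate_clusterMutate hC] at this

theorem IsGoodMatrix.of_mutationEquiv {C' : Matrix (Fin n) (Fin n) ℤ} (h : IsGoodMatrix C)
    (hm : MutationEquiv C C') : IsGoodMatrix C' := by
  induction hm with
  | refl => exact h
  | tail _ hk ih =>
    obtain ⟨k, rfl⟩ := hk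
    exact ih.clusterMutate k

end Invariance

section Dynkin

/-- The Cartan matrix of the path on the natural numbers. -/
def pathCartan (i j : ℕ) : ℤ :=
  if i = j then 2 else if i + 1 = j ∨ j + 1 = i then -1 else 0

theorem sum_pathCartan (u : ℕ → ℤ) (h0 : u 0 = 0) (N : ℕ) :
    ∑ i ∈ Finset.range N, ∑ j ∈ Finset.range N, u (i + 1) * (pathCartan i j * u (j + 1)) =
      ∑ i ∈ Finset.range N, (u (i + 1) - u i) ^ 2 + u N ^ 2 := by
  have key : ∀ N, ∑ j ∈ Finset.range N, pathCartan N j * u (j + 1) = -u N := by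
    intro N
    cases N with
    | zero => simp [h0]
    | succ N =>
      rw [Finset.sum_range_succ, Finset.sum_eq_zero]
      · simp [pathCartan]
      · intro j hj
        rw [Finset.mem_range] at hj
        simp [pathCartan, show N + 1 ≠ j by omega, show N + 1 + 1 ≠ j by omega, show j ≠ N by omega]
  have hsymm : ∀ i j, pathCartan i j = pathCartan j i := fun i j => by
    simp only [pathCartan, eq_comm (a := i) (b := j), or_comm (a := i + 1 = j)]
  induction N with
  | zero => simp [h0]
  | succ N ih =>
    simp only [Finset.sum_range_succ (n := N), Finset.sum_add_distrib, ih]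
    rw [← Finset.mul_sum, key]
    have e : ∑ x ∈ Finset.range N, u (x + 1) * (pathCartan x N * u (N + 1)) = -u N * u (N + 1) := by
      rw [← key, Finset.sum_mul]
      exact Finset.sum_congr rfl fun j _ => by rw [hsymm j N]; ring
    rw [e]
    simp only [pathCartan, if_true]
    ring

theorem eq_zero_of_sum_sq_eq_zero {u : ℕ → ℤ} (h0 : u 0 = 0) {N : ℕ}
    (h : ∑ i ∈ Finset.range N, (u (i + 1) - u i) ^ 2 ≤ 0) : ∀ i ≤ N, u i = 0 := by
  have h1 := (Finset.sum_eq_zero_iff_of_nonneg fun i _ => sq_nonneg (u (i + 1) - u i)).mp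
    (le_antisymm h (Finset.sum_nonneg fun i _ => sq_nonneg (u (i + 1) - u i)))
  intro i hi
  induction i with
  | zero => exact h0
  | succ i ih =>
    have h2 := h1 i (Finset.mem_range.mpr (by omega))
    rw [pow_eq_zero_iff two_ne_zero, ih (by omega), sub_zero] at h2
    exact h2

/-- The values of a vector on `Fin n` shifted by one and extended by zero. -/
def shiftExtend {n : ℕ} (x : Fin n → ℤ) (N t : ℕ) : ℤ :=
  if h : 1 ≤ t ∧ t ≤ N ∧ t - 1 < n then x ⟨t - 1, h.2.2⟩ else 0

theorem posDef_of_path {n : ℕ} (A : Matrix (Fin n) (Fin n) ℤ)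
    (hA : ∀ i j : Fin n, A i j = pathCartan i j) (x : Fin n → ℤ) (hx : x ≠ 0) :
    0 < x ⬝ᵥ A.mulVec x := by
  set u := shiftExtend x n with hu
  have hux : ∀ i : Fin n, x i = u (i + 1) := fun i => by simp [hu, shiftExtend]
  have h0 : u 0 = 0 := by simp [hu, shiftExtend]
  have e : x ⬝ᵥ A.mulVec x = ∑ i ∈ Finset.range n, (u (i + 1) - u i) ^ 2 + u n ^ 2 := by
    rw [← sum_pathCartan u h0, ← Fin.sum_univ_eq_sum_range
      (fun i => ∑ j ∈ Finset.range n, u (i + 1) * (pathCartan i j * u (j + 1)))]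
    simp only [dotProduct, Matrix.mulVec, Finset.mul_sum, hA, hux]
    refine Finset.sum_congr rfl fun i _ => ?_
    rw [← Fin.sum_univ_eq_sum_range (fun j => u (i + 1) * (pathCartan i j * u (j + 1)))]
  rw [e]
  by_contra hc
  have h1 := eq_zero_of_sum_sq_eq_zero h0 (N := n) (by nlinarith [sq_nonneg (u n)])
  exact hx (funext fun i => by rw [hux, h1 _ (by omega)]; rfl)

theorem posDef_of_star {N c : ℕ} (hc : c < N) (hN : (c + 1) * (N - c) < 2 * ((c + 1) + (N - c)))
    (A : Matrix (Fin (N + 1)) (Fin (N + 1)) ℤ)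
    (hA : ∀ i j : Fin N, A i.castSucc j.castSucc = pathCartan i j)
    (h1 : ∀ i : Fin N, A i.castSucc (Fin.last N) = if (i : ℕ) = c then -1 else 0)
    (h2 : ∀ i : Fin N, A (Fin.last N) i.castSucc = if (i : ℕ) = c then -1 else 0)
    (h3 : A (Fin.last N) (Fin.last N) = 2) (x : Fin (N + 1) → ℤ) (hx : x ≠ 0) :
    0 < x ⬝ᵥ A.mulVec x := by
  set u := shiftExtend x N with hu
  set z := x (Fin.last N) with hz
  have hux : ∀ i : Fin N, x i.castSucc = u (i + 1) := fun i => by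
    simp only [hu, shiftExtend]
    rw [dif_pos (by omega)]
    rfl
  have h0 : u 0 = 0 := by simp [hu, shiftExtend]
  have hlast : u (N + 1) = 0 := by simp [hu, shiftExtend]
  have e : x ⬝ᵥ A.mulVec x =
      ∑ i ∈ Finset.range (N + 1), (u (i + 1) - u i) ^ 2 + 2 * z ^ 2 - 2 * z * u (c + 1) := by
    have ec : ∑ i : Fin N, (if (i : ℕ) = c then (-1 : ℤ) else 0) * u (i + 1) = -u (c + 1) := by
      rw [Fin.sum_univ_eq_sum_range (fun i => (if i = c then (-1 : ℤ) else 0) * u (i + 1)),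
        Finset.sum_eq_single c]
      · simp
      · intro b _ hb; simp [hb]
      · intro hcN; exact absurd (Finset.mem_range.mpr hc) hcN
    have ep : ∑ i : Fin N, u (i + 1) * ∑ j : Fin N, pathCartan i j * u (j + 1) =
        ∑ i ∈ Finset.range N, (u (i + 1) - u i) ^ 2 + u N ^ 2 := by
      rw [← sum_pathCartan u h0, ← Fin.sum_univ_eq_sum_range
        (fun i => ∑ j ∈ Finset.range N, u (i + 1) * (pathCartan i j * u (j + 1)))]
      refine Finset.sum_congr rfl fun i _ => ?_
      rw [← Fin.sum_univ_eq_sum_range (fun j => u (i + 1) * (pathCartan i j * u (j + 1))),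
        Finset.mul_sum]
    have ez : ∑ i : Fin N, u (i + 1) * ((if (i : ℕ) = c then (-1 : ℤ) else 0) * z) =
        -u (c + 1) * z := by
      rw [← ec, Finset.sum_mul]
      exact Finset.sum_congr rfl fun i _ => by ring
    simp only [dotProduct, Matrix.mulVec, Fin.sum_univ_castSucc, hA, h1, h2, h3, hux, ← hz, mul_add,
      Finset.sum_add_distrib, Finset.sum_range_succ (n := N), hlast]
    simp only [ep, ez]
    rw [ec]
    ring
  rw [e]
  set w := u (c + 1) with hw
  have hsplit : ∑ i ∈ Finset.range (N + 1), (u (i + 1) - u i) ^ 2 =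
      ∑ i ∈ Finset.range (c + 1), (u (i + 1) - u i) ^ 2 +
        ∑ i ∈ Finset.Ico (c + 1) (N + 1), (u (i + 1) - u i) ^ 2 :=
    (Finset.sum_range_add_sum_Ico _ (by omega)).symm
  have hS1 : w ^ 2 ≤ ((c + 1 : ℕ) : ℤ) * ∑ i ∈ Finset.range (c + 1), (u (i + 1) - u i) ^ 2 := by
    have := sq_sum_le_card_mul_sum_sq (s := Finset.range (c + 1)) (f := fun i => u (i + 1) - u i)
    rwa [Finset.sum_range_sub, h0, sub_zero, Finset.card_range] at this
  have hS2 : w ^ 2 ≤ ((N - c : ℕ) : ℤ) * ∑ i ∈ Finset.Ico (c + 1) (N + 1), (u (i + 1) - u i) ^ 2 := by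
    have := sq_sum_le_card_mul_sum_sq (s := Finset.Ico (c + 1) (N + 1))
      (f := fun i => u (i + 1) - u i)
    rwa [Finset.sum_Ico_sub _ (by omega), hlast, zero_sub, neg_sq, Nat.card_Ico,
      show N + 1 - (c + 1) = N - c by omega] at this
  have hS := sq_nonneg (2 * z - w)
  have hpq : ((c + 1 : ℕ) : ℤ) * ((N - c : ℕ) : ℤ) < 2 * (((c + 1 : ℕ) : ℤ) + ((N - c : ℕ) : ℤ)) := by
    exact_mod_cast hN
  have hp : (0 : ℤ) < ((c + 1 : ℕ) : ℤ) := by exact_mod_cast Nat.succ_pos c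
  have hq : (0 : ℤ) < ((N - c : ℕ) : ℤ) := by exact_mod_cast (by omega : 0 < N - c)
  by_contra hcon
  rw [hsplit] at hcon
  have hw0 : w = 0 := by
    generalize ∑ i ∈ Finset.range (c + 1), (u (i + 1) - u i) ^ 2 = S1 at *
    generalize ∑ i ∈ Finset.Ico (c + 1) (N + 1), (u (i + 1) - u i) ^ 2 = S2 at *
    generalize ((c + 1 : ℕ) : ℤ) = p at *
    generalize ((N - c : ℕ) : ℤ) = q at *
    have k1 : 2 * (S1 + S2) ≤ w ^ 2 := by nlinarith
    have k2 : q * w ^ 2 ≤ q * (p * S1) := mul_le_mul_of_nonneg_left hS1 hq.le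
    have k3 : p * w ^ 2 ≤ p * (q * S2) := mul_le_mul_of_nonneg_left hS2 hp.le
    have k4 : p * q * (2 * (S1 + S2)) ≤ p * q * w ^ 2 :=
      mul_le_mul_of_nonneg_left k1 (mul_pos hp hq).le
    by_contra hne
    have : 0 < w ^ 2 := by positivity
    nlinarith
  rw [hw0, ← hsplit] at hcon
  have hz0 : z = 0 := by
    have := Finset.sum_nonneg fun i (_ : i ∈ Finset.range (N + 1)) => sq_nonneg (u (i + 1) - u i)
    have : z ^ 2 = 0 := by nlinarith [sq_nonneg z]
    simpa using this
  have hall := eq_zero_of_sum_sq_eq_zero h0 (N := N + 1) (by nlinarith [sq_nonneg z])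
  refine hx (funext fun i => ?_)
  induction i using Fin.lastCases with
  | last => exact hz0
  | cast i => rw [hux, hall _ (by omega)]; rfl

/-- The symmetric matrix with diagonal entries `2` and off-diagonal entries `-|B i j|`. -/
def cartanCompanion {n : ℕ} (B : Matrix (Fin n) (Fin n) ℤ) : Matrix (Fin n) (Fin n) ℤ :=
  Matrix.of fun i j => if i = j then 2 else -|B i j|

theorem isGoodMatrix_of_posDef {n : ℕ} {B : Matrix (Fin n) (Fin n) ℤ}
    (hs : ∀ i j, B j i = -B i j)
    (hpos : ∀ x : Fin n → ℤ, x ≠ 0 → 0 < x ⬝ᵥ (cartanCompanion B).mulVec x) : IsGoodMatrix B := by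
  have hA : IsPositiveCompanion (cartanCompanion B) B := by
    refine ⟨fun i j => ?_, fun i => by simp [cartanCompanion], fun i j hij => ?_, hpos⟩
    · simp only [cartanCompanion, Matrix.of_apply, hs i j, abs_neg, eq_comm (a := i)]
    · simp [cartanCompanion, hij]
  have hsign := hA.isSignMatrix hs
  have hneg : ∀ i j, i ≠ j → B i j ≠ 0 → cartanCompanion B i j = -1 := fun i j hij hB => by
    rcases (hsign i j).resolve_left hB with e | e <;> simp [cartanCompanion, hij, e]
  refine ⟨hs, ⟨_, hA⟩, ?_⟩
  rintro ⟨s, a, b, hab, hp, hl⟩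
  obtain ⟨P, l, h, rfl, rfl⟩ := hl.exists_isDetour hs hab hp
  have hP := h.isInducedPath hs hab
  have hone : ∀ t ≤ l, pathSign (cartanCompanion B) P t = 1 := by
    intro t ht
    induction t with
    | zero => rfl
    | succ t ih =>
      rw [pathSign, ih (by omega), hneg _ _ (hP.ne t (t + 1) (by omega) ht)
        ((hP.adj t (t + 1) (by omega) ht).mpr rfl)]
      norm_num
  have hPs : ∀ t ≤ l, B (P t) s ≠ 0 ↔ t = 0 ∨ t = l := fun t ht => by
    rw [hs s, neg_ne_zero, h.nbr t ht]
  have key := hA.pathSign_add_eq_zero hP h.pos le_rfl h.avoid ((hPs 0 (by omega)).mpr (.inl rfl))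
    ((hPs l le_rfl).mpr (.inr rfl)) fun t h1 h2 => by
      by_contra hc
      have := (hPs t (by omega)).mp hc
      omega
  rw [hone 0 (by omega), hone l le_rfl, hneg _ _ (h.avoid 0 (by omega))
    ((hPs 0 (by omega)).mpr (.inl rfl)), hneg _ _ (h.avoid l le_rfl)
    ((hPs l le_rfl).mpr (.inr rfl))] at key
  norm_num at key

theorem cartanCompanion_eq {n : ℕ} {B : Matrix (Fin n) (Fin n) ℤ} {adj : Fin n → Fin n → Prop}
    (h : IsOrientationOf B adj) (i j : Fin n) :
    (i = j → cartanCompanion B i j = 2) ∧ (i ≠ j → adj i j → cartanCompanion B i j = -1) ∧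
      (i ≠ j → ¬ adj i j → cartanCompanion B i j = 0) := by
  obtain ⟨_, h2, h3⟩ := h
  refine ⟨fun e => by simp [cartanCompanion, e], fun hij ha => ?_, fun hij ha => ?_⟩
  · have hB := (h3 i j).mpr ha
    have : |B i j| = 1 := le_antisymm (h2 i j) (Int.one_le_abs hB)
    simp [cartanCompanion, hij, this]
  · rw [← h3, not_not] at ha
    simp [cartanCompanion, hij, ha]

theorem isGoodMatrix_of_star {N c : ℕ} (hc : c < N)
    (hN : (c + 1) * (N - c) < 2 * ((c + 1) + (N - c)))
    {B : Matrix (Fin (N + 1)) (Fin (N + 1)) ℤ} {adj : Fin (N + 1) → Fin (N + 1) → Prop}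
    (h : IsOrientationOf B adj)
    (hadj : ∀ i j : Fin (N + 1), adj i j ↔ ((i : ℕ) + 1 = j ∧ (j : ℕ) ≤ N - 1) ∨
      ((j : ℕ) + 1 = i ∧ (i : ℕ) ≤ N - 1) ∨ ((i : ℕ) = c ∧ (j : ℕ) = N) ∨
        ((j : ℕ) = c ∧ (i : ℕ) = N)) : IsGoodMatrix B := by
  have hval := cartanCompanion_eq h
  refine isGoodMatrix_of_posDef h.1 (posDef_of_star hc hN _ (fun i j => ?_) (fun i => ?_)
    (fun i => ?_) ((hval _ _).1 rfl))
  · obtain ⟨e1, e2, e3⟩ := hval i.castSucc j.castSucc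
    rw [hadj] at e2 e3
    simp only [Fin.val_castSucc, ne_eq, Fin.ext_iff] at e1 e2 e3
    unfold pathCartan
    split_ifs with hi hi'
    · exact e1 hi
    · exact e2 hi (by omega)
    · exact e3 hi (by omega)
  · obtain ⟨e1, e2, e3⟩ := hval i.castSucc (Fin.last N)
    rw [hadj] at e2 e3
    simp only [Fin.val_castSucc, Fin.val_last, ne_eq, Fin.ext_iff, and_true] at e1 e2 e3
    split_ifs with hi
    · exact e2 (by omega) (by omega)
    · exact e3 (by omega) (by omega)
  · obtain ⟨e1, e2, e3⟩ := hval (Fin.last N) i.castSucc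
    rw [hadj] at e2 e3
    simp only [Fin.val_castSucc, Fin.val_last, ne_eq, Fin.ext_iff, and_true] at e1 e2 e3
    split_ifs with hi
    · exact e2 (by omega) (by omega)
    · exact e3 (by omega) (by omega)

theorem IsDynkinADEOrientation.isGoodMatrix {n : ℕ} {B : Matrix (Fin n) (Fin n) ℤ}
    (h : IsDynkinADEOrientation B) : IsGoodMatrix B := by
  rcases h with h | ⟨hn, h⟩ | ⟨hn, h⟩
  · refine isGoodMatrix_of_posDef h.1 (posDef_of_path _ fun i j => ?_)
    obtain ⟨e1, e2, e3⟩ := cartanCompanion_eq h i j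
    unfold pathCartan
    simp only [adjA, ne_eq, Fin.ext_iff] at e1 e2 e3
    split_ifs with hi hi'
    · exact e1 hi
    · exact e2 hi hi'
    · exact e3 hi hi'
  · obtain ⟨N, rfl⟩ : ∃ N, n = N + 1 := ⟨n - 1, by omega⟩
    refine isGoodMatrix_of_star (c := N - 2) (by omega) ?_ h fun i j => ?_
    · rw [show N - (N - 2) = 2 by omega]; omega
    · simp only [adjD]; omega
  · obtain ⟨N, rfl⟩ : ∃ N, n = N + 1 := ⟨n - 1, by omega⟩
    refine isGoodMatrix_of_star (c := 2) (by omega) (by omega) h fun i j => ?_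
    simp only [adjE]; omega

theorem IsFiniteTypeClusterMatrix.isGoodMatrix {n : ℕ} {B : Matrix (Fin n) (Fin n) ℤ}
    (h : IsFiniteTypeClusterMatrix B) : IsGoodMatrix B := by
  obtain ⟨B₀, h₀, hm⟩ := h
  exact h₀.isGoodMatrix.of_mutationEquiv hm

end Dynkin

section Logarithms

/-- The identification of the coordinate plane with the complex numbers. -/
def planeToComplex (z : ℝ × ℝ) : ℂ := ⟨z.1, z.2⟩

theorem continuous_planeToComplex : Continuous planeToComplex :=
  Complex.equivRealProdCLM.symm.continuous

theorem dist_le_norm_planeToComplex (z w : ℝ × ℝ) :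
    dist z w ≤ ‖planeToComplex z - planeToComplex w‖ := by
  rw [Prod.dist_eq, max_le_iff, Real.dist_eq, Real.dist_eq]
  exact ⟨by simpa [planeToComplex] using
      Complex.abs_re_le_norm (planeToComplex z - planeToComplex w),
    by simpa [planeToComplex] using Complex.abs_im_le_norm (planeToComplex z - planeToComplex w)⟩

theorem planeToComplex_sub_ne_zero {z w : ℝ × ℝ} (h : z ≠ w) :
    planeToComplex z - planeToComplex w ≠ 0 := fun e => h <| by
  have := dist_le_norm_planeToComplex z w
  rw [e, norm_zero] at this
  exact dist_le_zero.mp this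

/-- The function `z ↦ (z - p) / (z - q)` on the plane. -/
def planeRatio (p q z : ℝ × ℝ) : ℂ :=
  (planeToComplex z - planeToComplex p) / (planeToComplex z - planeToComplex q)

theorem planeRatio_ne_zero {p q z : ℝ × ℝ} (hp : z ≠ p) (hq : z ≠ q) : planeRatio p q z ≠ 0 :=
  div_ne_zero (planeToComplex_sub_ne_zero hp) (planeToComplex_sub_ne_zero hq)

theorem continuousOn_planeRatio (p q : ℝ × ℝ) {S : Set (ℝ × ℝ)} (hq : q ∉ S) :
    ContinuousOn (planeRatio p q) S :=
  ContinuousOn.div (continuous_planeToComplex.sub continuous_const).continuousOn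
    (continuous_planeToComplex.sub continuous_const).continuousOn fun _ hz =>
    planeToComplex_sub_ne_zero fun e => hq (e ▸ hz)

/-- `g` has a continuous logarithm on `S`. -/
def HasLogOn {X : Type*} [TopologicalSpace X] (g : X → ℂ) (S : Set X) : Prop :=
  ∃ f, ContinuousOn f S ∧ ∀ z ∈ S, Complex.exp (f z) = g z

theorem exists_continuous_log {E : Type*} [AddCommGroup E] [Module ℝ E] [TopologicalSpace E]
    [IsTopologicalAddGroup E] [ContinuousSMul ℝ E] [LocallyPathConnectedSpace E] {g : E → ℂ}
    (hg : Continuous g) (h0 : ∀ z, g z ≠ 0) : ∃ f, Continuous f ∧ ∀ z, Complex.exp (f z) = g z := by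
  have hU : IsSimplyConnected (Set.univ : Set E) := by
    have := (convex_univ (𝕜 := ℝ) (E := E)).contractibleSpace Set.univ_nonempty
    exact SimplyConnectedSpace.ofContractible _
  obtain ⟨f, hf, hfg⟩ := Complex.exists_continuousOn_eqOn_exp_comp hU isOpen_univ
    hg.continuousOn (by rintro ⟨z, _, hz⟩; exact h0 z hz)
  exact ⟨f, continuousOn_univ.mp hf, fun z => hfg (Set.mem_univ z)⟩

theorem hasLogOn_Icc {g : ℝ → ℂ} (hg : ContinuousOn g (Set.Icc 0 1))
    (h0 : ∀ t ∈ Set.Icc (0 : ℝ) 1, g t ≠ 0) : HasLogOn g (Set.Icc 0 1) := by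
  obtain ⟨f, hf, hfg⟩ := exists_continuous_log (E := ℝ)
    (g := Set.IccExtend (zero_le_one' ℝ) ((Set.Icc 0 1).domRestrict g))
    (ContinuousOn.domRestrict hg).Icc_extend' (fun t => h0 _ (Subtype.mem _))
  refine ⟨f, hf.continuousOn, fun t ht => ?_⟩
  rw [hfg, Set.IccExtend_of_mem _ _ ht]
  rfl

theorem exists_int_of_exp_eq {X : Type*} [TopologicalSpace X] {S : Set X} (hS : IsPreconnected S)
    {u v : X → ℂ} (hu : ContinuousOn u S) (hv : ContinuousOn v S)
    (h : ∀ x ∈ S, Complex.exp (u x) = Complex.exp (v x)) :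
    ∃ n : ℤ, ∀ x ∈ S, u x = v x + n * (2 * Real.pi * Complex.I) := by
  rcases S.eq_empty_or_nonempty with rfl | ⟨x₀, hx₀⟩
  · exact ⟨0, by simp⟩
  have hmem : ∀ x ∈ S, ∃ n : ℤ, u x = v x + n * (2 * Real.pi * Complex.I) := fun x hx =>
    Complex.exp_eq_exp_iff_exists_int.mp (h x hx)
  obtain ⟨n, hn⟩ := hmem x₀ hx₀
  refine ⟨n, fun x hx => ?_⟩
  have hcount : (Set.range fun n : ℤ => (n : ℂ) * (2 * Real.pi * Complex.I)).Countable :=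
    Set.countable_range _
  have hsub := hcount.isTotallyDisconnected ((fun x => u x - v x) '' S)
    (by
      rintro _ ⟨x, hx, rfl⟩
      obtain ⟨n, hn⟩ := hmem x hx
      exact ⟨n, by simp only [hn]; ring⟩) (hS.image _ (hu.sub hv))
  have e := hsub ⟨x, hx, rfl⟩ ⟨x₀, hx₀, rfl⟩
  simp only [hn] at e
  linear_combination e

/-- The ratio function of a point inside and a point outside a bounded open set has no
logarithm on the frontier of this set. -/
theorem not_hasLogOn_frontier {D : Set (ℝ × ℝ)} (hb : Bornology.IsBounded D)
    {p q : ℝ × ℝ} (hp : p ∈ D) (hq : q ∉ closure D) :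
    ¬ HasLogOn (planeRatio p q) (frontier D) := by
  classical
  rintro ⟨f, hf, hfe⟩
  obtain ⟨F, hF⟩ := ContinuousMap.exists_restrict_eq (isClosed_frontier (s := D))
    ⟨_, ContinuousOn.domRestrict hf⟩
  have hF' : ∀ z ∈ frontier D, F z = f z := fun z hz =>
    congrArg (fun φ : C(frontier D, ℂ) => φ ⟨z, hz⟩) hF
  set g : ℝ × ℝ → ℂ := (closure D).piecewise
    (fun z => Complex.exp (F z) * (planeToComplex z - planeToComplex q))
    (fun z => planeToComplex z - planeToComplex p) with hg
  have hgc : Continuous g := by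
    refine Continuous.piecewise (fun z hz => ?_)
      ((Complex.continuous_exp.comp F.continuous).mul (continuous_planeToComplex.sub continuous_const))
      (continuous_planeToComplex.sub continuous_const)
    have hz' := frontier_closure_subset hz
    have hzq : z ≠ q := fun e => hq (e ▸ frontier_subset_closure hz')
    rw [hF' z hz', hfe z hz', planeRatio, div_mul_cancel₀ _ (planeToComplex_sub_ne_zero hzq)]
  have hg0 : ∀ z, g z ≠ 0 := by
    intro z
    by_cases hz : z ∈ closure D
    · rw [hg, Set.piecewise_eq_of_mem _ _ _ hz]
      exact mul_ne_zero (Complex.exp_ne_zero _) (planeToComplex_sub_ne_zero fun e => hq (e ▸ hz))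
    · rw [hg, Set.piecewise_eq_of_notMem _ _ _ hz]
      exact planeToComplex_sub_ne_zero fun e => hz (e ▸ subset_closure hp)
  obtain ⟨G, hG, hGe⟩ := exists_continuous_log hgc hg0
  obtain ⟨R, hR0, hR⟩ : ∃ R : ℝ, 0 < R ∧ ∀ z ∈ closure D, dist z p < R := by
    obtain ⟨R, hR⟩ := hb.closure.subset_ball p
    exact ⟨R, dist_nonneg.trans_lt (hR (subset_closure hp)), fun z hz => hR hz⟩
  set c : ℝ → ℝ × ℝ := fun θ => (p.1 + 2 * R * Real.cos θ, p.2 + 2 * R * Real.sin θ) with hc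
  have hcc : Continuous c := by fun_prop
  have hcp : ∀ θ, planeToComplex (c θ) - planeToComplex p = 2 * R * Complex.exp (θ * Complex.I) := by
    intro θ
    rw [Complex.exp_mul_I, ← Complex.ofReal_cos, ← Complex.ofReal_sin]
    apply Complex.ext <;> simp [hc, planeToComplex, -Complex.ofReal_cos, -Complex.ofReal_sin]
  have hcD : ∀ θ, c θ ∉ closure D := by
    intro θ hθ
    have h1 := hR _ hθ
    rw [Prod.dist_eq, max_lt_iff, Real.dist_eq, Real.dist_eq, abs_lt, abs_lt] at h1
    simp only [hc, add_sub_cancel_left] at h1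
    nlinarith [Real.sin_sq_add_cos_sq θ, mul_pos hR0 hR0]
  have hexp : ∀ θ, Complex.exp (G (c θ)) = 2 * R * Complex.exp (θ * Complex.I) := by
    intro θ
    rw [hGe, hg, Set.piecewise_eq_of_notMem _ _ _ (hcD θ), hcp]
  obtain ⟨n, hn⟩ := exists_int_of_exp_eq (S := Set.univ) (isPreconnected_univ)
    (u := fun θ : ℝ => G (c θ)) (v := fun θ : ℝ => G (c 0) + θ * Complex.I)
    (hG.comp hcc).continuousOn (by fun_prop) (fun θ _ => by
      rw [Complex.exp_add, hexp, hexp]; simp)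
  have h0 := hn 0 trivial
  have h1 := hn (2 * Real.pi) trivial
  have hper : c (2 * Real.pi) = c 0 := by simp [hc]
  rw [hper] at h1
  have : (2 * Real.pi * Complex.I : ℂ) = 0 := by
    push_cast at h0 h1
    linear_combination h0 - h1
  exact Complex.two_pi_I_ne_zero this

theorem hasLogOn_planeRatio {K : Set (ℝ × ℝ)} (hK : IsClosed K) {T : Set (ℝ × ℝ)}
    (hT : IsPreconnected T) (hTK : T ⊆ Kᶜ) {p q : ℝ × ℝ} (hp : p ∈ T) (hq : q ∈ T) :
    HasLogOn (planeRatio p q) K := by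
  refine hT.induction₂ (fun p q => HasLogOn (planeRatio p q) K) ?_ ?_ ?_ hp hq
  · intro p hp
    obtain ⟨ε, hε, hball⟩ := Metric.isOpen_iff.mp hK.isOpen_compl p (hTK hp)
    have hnear : ∀ᶠ q in nhdsWithin p T, ‖planeToComplex q - planeToComplex p‖ < ε / 2 := by
      refine nhdsWithin_le_nhds ?_
      have : Filter.Tendsto (fun q => ‖planeToComplex q - planeToComplex p‖) (nhds p) (nhds 0) := by
        have := (continuous_planeToComplex.sub (continuous_const (y := planeToComplex p))).norm.tendsto p
        simpa using this
      exact this.eventually_lt_const (by positivity)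
    filter_upwards [hnear, self_mem_nhdsWithin] with q hq hqT
    refine ⟨fun z => Complex.log (planeRatio p q z), ?_, fun z hz => ?_⟩
    · refine (continuousOn_planeRatio p q (hTK hqT)).clog fun z hz => ?_
      have hzp : ε ≤ ‖planeToComplex z - planeToComplex p‖ := by
        refine le_trans ?_ (dist_le_norm_planeToComplex z p)
        by_contra hlt
        exact hball (Metric.mem_ball.mpr (not_le.mp hlt)) hz
      have hzq : z ≠ q := fun e => hTK hqT (e ▸ hz)
      have e : planeRatio p q z = 1 + (planeToComplex q - planeToComplex p) /
          (planeToComplex z - planeToComplex q) := by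
        have := planeToComplex_sub_ne_zero hzq
        rw [planeRatio]
        field_simp
        ring
      rw [e]
      apply Complex.mem_slitPlane_of_norm_lt_one
      rw [norm_div, div_lt_one (norm_pos_iff.mpr (planeToComplex_sub_ne_zero hzq))]
      have := norm_sub_le_norm_sub_add_norm_sub (planeToComplex z) (planeToComplex q)
        (planeToComplex p)
      linarith
    · exact Complex.exp_log (planeRatio_ne_zero (fun e => hTK hp (e ▸ hz))
        (fun e => hTK hqT (e ▸ hz)))
  · rintro p q r hp hq hr ⟨f, hf, hfe⟩ ⟨g, hg, hge⟩
    refine ⟨fun z => f z + g z, hf.add hg, fun z hz => ?_⟩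
    have hzq : z ≠ q := fun e => hTK hq (e ▸ hz)
    rw [Complex.exp_add, hfe z hz, hge z hz, planeRatio, planeRatio, planeRatio,
      div_mul_div_cancel₀ (planeToComplex_sub_ne_zero hzq)]
  · rintro p q hp hq ⟨f, hf, hfe⟩
    refine ⟨fun z => -f z, hf.neg, fun z hz => ?_⟩
    rw [Complex.exp_neg, hfe z hz, planeRatio, planeRatio, inv_div]

end Logarithms

section Gluing

theorem continuousOn_image_of_isCompact {X Y Z : Type*} [TopologicalSpace X] [T2Space X]
    [TopologicalSpace Y] [T2Space Y] [TopologicalSpace Z] {K : Set X} (hK : IsCompact K)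
    {e : X → Y} (he : ContinuousOn e K) {f : Y → Z} {g : X → Z} (hg : ContinuousOn g K)
    (h : ∀ t ∈ K, f (e t) = g t) : ContinuousOn f (e '' K) := by
  rw [continuousOn_iff_isClosed]
  intro C hC
  have hcl : IsClosed (K ∩ g ⁻¹' C) := hg.preimage_isClosed_of_isClosed hK.isClosed hC
  refine ⟨e '' (K ∩ g ⁻¹' C), ?_, ?_⟩
  · exact ((hK.of_isClosed_subset hcl Set.inter_subset_left).image_of_continuousOn
      (he.mono Set.inter_subset_left)).isClosed
  · ext y
    constructor
    · rintro ⟨hy, t, ht, rfl⟩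
      exact ⟨⟨t, ⟨ht, by rw [Set.mem_preimage, ← h t ht]; exact hy⟩, rfl⟩, t, ht, rfl⟩
    · rintro ⟨⟨t, ⟨ht, htC⟩, rfl⟩, hy⟩
      exact ⟨by rw [Set.mem_preimage, h t ht]; exact htC, hy⟩

namespace PlaneEmb

variable {n : ℕ} {arr : Fin n → Fin n → Prop} (E : PlaneEmb arr)

theorem edge_eq_vtx {i j : Fin n} {h : arr i j} {t : ℝ} (ht : t ∈ Set.Icc (0 : ℝ) 1) {v : Fin n}
    (e : E.edge i j h t = E.vtx v) : t = 0 ∧ v = i ∨ t = 1 ∧ v = j := by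
  rcases eq_or_lt_of_le ht.1 with rfl | h0
  · rw [E.edge_src] at e
    exact .inl ⟨rfl, (E.vtx_inj e).symm⟩
  rcases eq_or_lt_of_le ht.2 with rfl | h1
  · rw [E.edge_tgt] at e
    exact .inr ⟨rfl, (E.vtx_inj e).symm⟩
  · exact absurd ⟨t, ⟨h0, h1⟩, e⟩ (E.edge_vtx i j h v)

/-- Logarithms on the edges of a plane quiver that agree at the vertices can be glued. -/
theorem hasLogOn_of_edges {φ : ℝ × ℝ → ℂ} {S : Set (ℝ × ℝ)} (hS : IsClosed S)
    (used : Fin n → Fin n → Prop)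
    (hsub : S ⊆ Set.range E.vtx ∪ ⋃ (i) (j) (h : arr i j) (_ : used i j), E.edge i j h '' Set.Icc 0 1)
    (a : Fin n → ℂ) (ha : ∀ v, Complex.exp (a v) = φ (E.vtx v)) (g : Fin n → Fin n → ℝ → ℂ)
    (hg : ∀ i j (h : arr i j), used i j →
      ContinuousOn (g i j) (Set.Icc 0 1 ∩ E.edge i j h ⁻¹' S) ∧
      (∀ t ∈ Set.Icc (0 : ℝ) 1, E.edge i j h t ∈ S → Complex.exp (g i j t) = φ (E.edge i j h t)) ∧
      g i j 0 = a i ∧ g i j 1 = a j) : HasLogOn φ S := by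
  classical
  let X := Fin n ⊕ ({p : Fin n × Fin n // arr p.1 p.2 ∧ used p.1 p.2} × Set.Icc (0 : ℝ) 1)
  let π : X → ℝ × ℝ := Sum.elim E.vtx fun x => E.edge x.1.1.1 x.1.1.2 x.1.2.1 x.2
  let val : X → ℂ := Sum.elim a fun x => g x.1.1.1 x.1.1.2 x.2
  have hve : ∀ (v : Fin n) (x : {p : Fin n × Fin n // arr p.1 p.2 ∧ used p.1 p.2})
      (t : Set.Icc (0 : ℝ) 1), E.vtx v = E.edge x.1.1 x.1.2 x.2.1 t → a v = g x.1.1 x.1.2 t := by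
    intro v x t e
    obtain ⟨_, _, h0, h1⟩ := hg _ _ x.2.1 x.2.2
    rcases E.edge_eq_vtx t.2 e.symm with ⟨ht, rfl⟩ | ⟨ht, rfl⟩
    · rw [ht, h0]
    · rw [ht, h1]
  have hfac : val.FactorsThrough π := by
    rintro (v | ⟨x, t⟩) (w | ⟨y, r⟩) e
    · exact congrArg a (E.vtx_inj e)
    · exact hve v y r e
    · exact (hve w x t e.symm).symm
    · by_cases hv : ∃ v, E.vtx v = E.edge x.1.1 x.1.2 x.2.1 t
      · obtain ⟨v, hv⟩ := hv
        exact (hve v x t hv).symm.trans (hve v y r (hv.trans e))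
      · have ht : (t : ℝ) ∈ Set.Ioo (0 : ℝ) 1 := by
          refine ⟨lt_of_le_of_ne t.2.1 fun h0 => hv ⟨x.1.1, ?_⟩,
            lt_of_le_of_ne t.2.2 fun h1 => hv ⟨x.1.2, ?_⟩⟩
          · rw [← h0, E.edge_src]
          · rw [h1, E.edge_tgt]
        by_cases hxy : x = y
        · subst hxy
          have : t = r := Subtype.ext (E.edge_inj _ _ x.2.1 t.2 r.2 e)
          rw [this]
        · have hd := E.edge_disj x.1.1 x.1.2 x.2.1 y.1.1 y.1.2 y.2.1
            (fun h => hxy (Subtype.ext h))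
          exact (Set.eq_empty_iff_forall_notMem.mp hd (E.edge _ _ x.2.1 t)
            ⟨⟨t, ht, rfl⟩, ⟨r, r.2, e.symm⟩⟩).elim
  let f : ℝ × ℝ → ℂ := Function.extend π val 0
  have hf : ∀ x, f (π x) = val x := fun x => hfac.extend_apply 0 x
  have hfv : ∀ v, f (E.vtx v) = a v := fun v => hf (.inl v)
  have hfe : ∀ i j (h : arr i j) (_ : used i j), ∀ t ∈ Set.Icc (0 : ℝ) 1,
      f (E.edge i j h t) = g i j t := fun i j h hu t ht =>
    hf (.inr (⟨(i, j), h, hu⟩, ⟨t, ht⟩))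
  refine ⟨f, ?_, fun z hz => ?_⟩
  · let piece : Fin n ⊕ {p : Fin n × Fin n // arr p.1 p.2 ∧ used p.1 p.2} → Set (ℝ × ℝ) :=
      Sum.elim (fun v => {E.vtx v}) fun x => E.edge x.1.1 x.1.2 x.2.1 ''
        (Set.Icc 0 1 ∩ E.edge x.1.1 x.1.2 x.2.1 ⁻¹' S)
    have hcomp : ∀ x : {p : Fin n × Fin n // arr p.1 p.2 ∧ used p.1 p.2},
        IsCompact (Set.Icc 0 1 ∩ E.edge x.1.1 x.1.2 x.2.1 ⁻¹' S) := fun x =>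
      isCompact_Icc.of_isClosed_subset
        ((E.edge_cont _ _ _).preimage_isClosed_of_isClosed isClosed_Icc hS) Set.inter_subset_left
    have hcont : ∀ x, ContinuousOn f (piece x) := by
      rintro (v | x)
      · exact continuousOn_singleton _ _
      · exact continuousOn_image_of_isCompact (hcomp x) ((E.edge_cont _ _ _).mono
          Set.inter_subset_left) (hg _ _ x.2.1 x.2.2).1 fun t ht => hfe _ _ x.2.1 x.2.2 t ht.1
    have hclosed : ∀ x, IsClosed (piece x) := by
      rintro (v | x)
      · exact isClosed_singleton
      · exact ((hcomp x).image_of_continuousOn ((E.edge_cont _ _ _).mono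
          Set.inter_subset_left)).isClosed
    refine ((locallyFinite_of_finite piece).continuousOn_iUnion hclosed hcont).mono fun z hz => ?_
    rw [Set.mem_iUnion]
    rcases hsub hz with ⟨v, rfl⟩ | hz'
    · exact ⟨.inl v, rfl⟩
    · simp only [Set.mem_iUnion] at hz'
      obtain ⟨i, j, h, hu, t, ht, rfl⟩ := hz'
      exact ⟨.inr ⟨(i, j), h, hu⟩, t, ⟨ht, hz⟩, rfl⟩
  · rcases hsub hz with ⟨v, rfl⟩ | hz'
    · rw [hfv, ha]
    · simp only [Set.mem_iUnion] at hz'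
      obtain ⟨i, j, h, hu, t, ht, rfl⟩ := hz'
      rw [hfe i j h hu t ht, (hg i j h hu).2.1 t ht hz]

theorem isCompact_edge (i j : Fin n) (h : arr i j) : IsCompact (E.edge i j h '' Set.Icc 0 1) :=
  isCompact_Icc.image_of_continuousOn (E.edge_cont i j h)

theorem edge_mem_image {i j : Fin n} (h : arr i j) {t : ℝ} (ht : t ∈ Set.Icc (0 : ℝ) 1) :
    E.edge i j h t ∈ E.image :=
  .inr (Set.mem_iUnion.mpr ⟨i, Set.mem_iUnion.mpr ⟨j, Set.mem_iUnion.mpr ⟨h, t, ht, rfl⟩⟩⟩)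

theorem isCompact_image : IsCompact E.image :=
  (Set.finite_range E.vtx).isCompact.union <|
    isCompact_iUnion fun i => isCompact_iUnion fun j => isCompact_iUnion fun h =>
      E.isCompact_edge i j h

/-- Logarithms of a function along the edges of a plane quiver, and their defects. -/
structure EdgeLogs (φ : ℝ × ℝ → ℂ) where
  base : Fin n → ℂ
  exp_base : ∀ v, Complex.exp (base v) = φ (E.vtx v)
  log : Fin n → Fin n → ℝ → ℂ
  cont : ∀ i j, arr i j → ContinuousOn (log i j) (Set.Icc 0 1)
  exp_log : ∀ i j (h : arr i j), ∀ t ∈ Set.Icc (0 : ℝ) 1,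
    Complex.exp (log i j t) = φ (E.edge i j h t)
  defect : Fin n → Fin n → ℤ
  log_zero : ∀ i j, arr i j → log i j 0 = base i
  log_one : ∀ i j, arr i j → log i j 1 = base j + defect i j * (2 * Real.pi * Complex.I)

theorem nonempty_edgeLogs {φ : ℝ × ℝ → ℂ} (hφ : ContinuousOn φ E.image)
    (h0 : ∀ z ∈ E.image, φ z ≠ 0) : Nonempty (E.EdgeLogs φ) := by
  have hv : ∀ v, Complex.exp (Complex.log (φ (E.vtx v))) = φ (E.vtx v) := fun v =>
    Complex.exp_log (h0 _ (.inl ⟨v, rfl⟩))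
  have key : ∀ i j, ∃ (f : ℝ → ℂ) (w : ℤ), ∀ h : arr i j, ContinuousOn f (Set.Icc 0 1) ∧
      (∀ t ∈ Set.Icc (0 : ℝ) 1, Complex.exp (f t) = φ (E.edge i j h t)) ∧
      f 0 = Complex.log (φ (E.vtx i)) ∧
      f 1 = Complex.log (φ (E.vtx j)) + w * (2 * Real.pi * Complex.I) := by
    intro i j
    by_cases h : arr i j
    · obtain ⟨f, hf, hfe⟩ := hasLogOn_Icc (g := fun t => φ (E.edge i j h t))
        (hφ.comp (E.edge_cont i j h) fun t ht => E.edge_mem_image h ht)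
        fun t ht => h0 _ (E.edge_mem_image h ht)
      have e0 := hfe 0 (by simp)
      have e1 := hfe 1 (by simp)
      simp only [E.edge_src, E.edge_tgt] at e0 e1
      rw [← hv, Complex.exp_eq_exp_iff_exists_int] at e0 e1
      obtain ⟨p, hp⟩ := e0
      obtain ⟨q, hq⟩ := e1
      refine ⟨fun t => f t + (-p : ℤ) * (2 * Real.pi * Complex.I), q - p, fun _ =>
        ⟨hf.add continuousOn_const, fun t ht => ?_, ?_, ?_⟩⟩
      · rw [Complex.exp_add, hfe t ht, Complex.exp_int_mul_two_pi_mul_I, mul_one]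
      · beta_reduce; rw [hp]; push_cast; ring
      · beta_reduce; rw [hq]; push_cast; ring
    · exact ⟨0, 0, fun h' => absurd h' h⟩
  choose f w hfw using key
  exact ⟨⟨fun v => Complex.log (φ (E.vtx v)), hv, f, fun i j h => (hfw i j h).1,
    fun i j h => (hfw i j h).2.1, w, fun i j h => (hfw i j h).2.2.1,
    fun i j h => (hfw i j h).2.2.2⟩⟩

variable {E}

/-- There is a logarithm if the defects form a coboundary on the edges that are not cut. -/
theorem EdgeLogs.hasLogOn {φ : ℝ × ℝ → ℂ} (Λ : E.EdgeLogs φ) {S : Set (ℝ × ℝ)} (hS : IsClosed S)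
    (used : Fin n → Fin n → Prop)
    (hsub : S ⊆ Set.range E.vtx ∪ ⋃ (i) (j) (h : arr i j) (_ : used i j), E.edge i j h '' Set.Icc 0 1)
    (b : Fin n → ℤ)
    (hb : ∀ i j (h : arr i j), used i j → Λ.defect i j = b j - b i ∨
      ∃ t₀ ∈ Set.Ioo (0 : ℝ) 1, E.edge i j h t₀ ∉ S) : HasLogOn φ S := by
  classical
  have key : ∀ i j, ∃ g : ℝ → ℂ, ∀ h : arr i j, used i j →
      ContinuousOn g (Set.Icc 0 1 ∩ E.edge i j h ⁻¹' S) ∧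
      (∀ t ∈ Set.Icc (0 : ℝ) 1, E.edge i j h t ∈ S → Complex.exp (g t) = φ (E.edge i j h t)) ∧
      g 0 = Λ.base i + b i * (2 * Real.pi * Complex.I) ∧
      g 1 = Λ.base j + b j * (2 * Real.pi * Complex.I) := by
    intro i j
    by_cases h : arr i j ∧ used i j
    swap
    · exact ⟨0, fun h1 h2 => absurd ⟨h1, h2⟩ h⟩
    obtain ⟨h, hu⟩ := h
    rcases hb i j h hu with hd | ⟨t₀, ht₀, hS₀⟩
    · refine ⟨fun t => Λ.log i j t + b i * (2 * Real.pi * Complex.I), fun _ _ =>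
        ⟨((Λ.cont i j h).mono Set.inter_subset_left).add continuousOn_const, fun t ht _ => ?_, ?_, ?_⟩⟩
      · rw [Complex.exp_add, Λ.exp_log i j h t ht, Complex.exp_int_mul_two_pi_mul_I, mul_one]
      · beta_reduce; rw [Λ.log_zero i j h]
      · beta_reduce; rw [Λ.log_one i j h, hd]; push_cast; ring
    · refine ⟨fun t => Λ.log i j t + ((if t < t₀ then b i else b j - Λ.defect i j : ℤ) : ℂ) *
        (2 * Real.pi * Complex.I), fun _ _ => ⟨?_, fun t ht _ => ?_, ?_, ?_⟩⟩
      · refine ((Λ.cont i j h).mono Set.inter_subset_left).add fun t ht => ?_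
        have hne : t ≠ t₀ := fun e => hS₀ (e ▸ ht.2)
        refine ContinuousAt.continuousWithinAt ?_
        rcases lt_or_gt_of_ne hne with hlt | hgt
        · refine (continuousAt_const (y := (b i : ℂ) * (2 * Real.pi * Complex.I))).congr ?_
          filter_upwards [eventually_lt_nhds hlt] with r hr
          rw [if_pos hr]
        · refine (continuousAt_const
            (y := ((b j - Λ.defect i j : ℤ) : ℂ) * (2 * Real.pi * Complex.I))).congr ?_
          filter_upwards [eventually_gt_nhds hgt] with r hr
          rw [if_neg (not_lt.mpr hr.le)]
      · rw [Complex.exp_add, Λ.exp_log i j h t ht, Complex.exp_int_mul_two_pi_mul_I, mul_one]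
      · simp only [if_pos ht₀.1, Λ.log_zero i j h]
      · simp only [if_neg (not_lt.mpr ht₀.2.le), Λ.log_one i j h]; push_cast; ring
  choose g hg using key
  refine E.hasLogOn_of_edges hS used hsub (fun v => Λ.base v + b v * (2 * Real.pi * Complex.I))
    (fun v => ?_) g hg
  rw [Complex.exp_add, Λ.exp_base, Complex.exp_int_mul_two_pi_mul_I, mul_one]

/-- The values at the vertices of a logarithm on some edges trivialize the defects. -/
theorem EdgeLogs.exists_potential {φ : ℝ × ℝ → ℂ} (Λ : E.EdgeLogs φ) {S : Set (ℝ × ℝ)}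
    (h : HasLogOn φ S) : ∃ β : Fin n → ℂ, ∀ i j (hij : arr i j),
      E.edge i j hij '' Set.Icc 0 1 ⊆ S → (Λ.defect i j : ℂ) = β j - β i := by
  obtain ⟨f, hf, hfe⟩ := h
  refine ⟨fun v => (f (E.vtx v) - Λ.base v) / (2 * Real.pi * Complex.I), fun i j hij hS => ?_⟩
  obtain ⟨N, hN⟩ := exists_int_of_exp_eq (isPreconnected_Icc (a := (0 : ℝ)) (b := 1))
    (u := fun t => f (E.edge i j hij t)) (v := Λ.log i j)
    (hf.comp (E.edge_cont i j hij) fun t ht => hS ⟨t, ht, rfl⟩) (Λ.cont i j hij) fun t ht => by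
      rw [hfe _ (hS ⟨t, ht, rfl⟩), Λ.exp_log i j hij t ht]
  have e0 := hN 0 (by simp)
  have e1 := hN 1 (by simp)
  rw [E.edge_src, Λ.log_zero i j hij] at e0
  rw [E.edge_tgt, Λ.log_one i j hij] at e1
  beta_reduce
  rw [e0, e1, ← sub_div, eq_div_iff Complex.two_pi_I_ne_zero]
  ring

end PlaneEmb

end Gluing

section DiscreteCycles

variable {n : ℕ} {B W : Matrix (Fin n) (Fin n) ℤ}

/-- A closed walk of length `m`, as an `m`-periodic sequence of vertices. -/
structure IsClosedSeq (B : Matrix (Fin n) (Fin n) ℤ) (m : ℕ) (c : ℕ → Fin n) : Prop where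
  periodic : ∀ t, c (t + m) = c t
  adj : ∀ t, B (c t) (c (t + 1)) ≠ 0

/-- The sum of `W` along the first `m` steps of a sequence. -/
def seqSum (W : Matrix (Fin n) (Fin n) ℤ) (m : ℕ) (c : ℕ → Fin n) : ℤ :=
  ∑ t ∈ Finset.range m, W (c t) (c (t + 1))

theorem isClosedSeq_mod {P : ℕ → Fin n} {m : ℕ} (h : ∀ t < m, B (P t) (P (t + 1)) ≠ 0)
    (h' : B (P m) (P 0) ≠ 0) : IsClosedSeq B (m + 1) (fun t => P (t % (m + 1))) := by
  refine ⟨fun t => by rw [Nat.add_mod_right], fun t => ?_⟩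
  have hlt : t % (m + 1) < m + 1 := Nat.mod_lt t (Nat.succ_pos m)
  rw [Nat.add_mod_eq_ite]
  rcases Nat.lt_or_ge (t % (m + 1)) m with hm | hm
  · rcases Nat.eq_zero_or_pos m with rfl | hpos
    · omega
    · rw [Nat.mod_eq_of_lt (show 1 < m + 1 by omega), if_neg (by omega)]
      exact h _ hm
  · have e : t % (m + 1) = m := by omega
    rcases Nat.eq_zero_or_pos m with rfl | hpos
    · simpa [Nat.mod_one] using h'
    · rw [Nat.mod_eq_of_lt (show 1 < m + 1 by omega), if_pos (by omega), e, Nat.sub_self]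
      exact h'

theorem seqSum_mod (P : ℕ → Fin n) (m : ℕ) :
    seqSum W (m + 1) (fun t => P (t % (m + 1))) = seqSum W m P + W (P m) (P 0) := by
  rw [seqSum, Finset.sum_range_succ, seqSum]
  congr 1
  · refine Finset.sum_congr rfl fun t ht => ?_
    rw [Finset.mem_range] at ht
    rw [Nat.mod_eq_of_lt (by omega), Nat.mod_eq_of_lt (by omega)]
  · rw [Nat.mod_eq_of_lt (by omega), Nat.mod_self]

theorem exists_isClosedSeq {P : ℕ → Fin n} {m : ℕ} (hm : 0 < m)
    (h : ∀ t < m, B (P t) (P (t + 1)) ≠ 0) (h' : P m = P 0) :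
    ∃ c, IsClosedSeq B m c ∧ seqSum W m c = seqSum W m P := by
  obtain ⟨k, rfl⟩ : ∃ k, m = k + 1 := ⟨m - 1, by omega⟩
  refine ⟨_, isClosedSeq_mod (fun t ht => h t (by omega)) (h' ▸ h k (by omega)), ?_⟩
  rw [seqSum_mod, ← h', seqSum, seqSum, Finset.sum_range_succ]

theorem seqSum_add (c : ℕ → Fin n) (k l : ℕ) :
    seqSum W (k + l) c = seqSum W k c + seqSum W l (fun t => c (k + t)) :=
  Finset.sum_range_add _ k l

theorem IsClosedSeq.shift {m : ℕ} {c : ℕ → Fin n} (h : IsClosedSeq B m c) (a : ℕ) :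
    IsClosedSeq B m (fun t => c (a + t)) :=
  ⟨fun t => by rw [← add_assoc, h.periodic], fun t => h.adj (a + t)⟩

theorem IsClosedSeq.seqSum_shift {m : ℕ} {c : ℕ → Fin n} (h : IsClosedSeq B m c) (a : ℕ) :
    seqSum W m (fun t => c (a + t)) = seqSum W m c := by
  have h1 := seqSum_add (W := W) c a m
  have h2 := seqSum_add (W := W) c m a
  have h3 : seqSum W a (fun t => c (m + t)) = seqSum W a c := by
    refine Finset.sum_congr rfl fun t _ => ?_
    beta_reduce
    rw [show m + (t + 1) = t + 1 + m by ring, show m + t = t + m by ring, h.periodic, h.periodic]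
  rw [add_comm m a, h3] at h2
  linarith

theorem IsClosedSeq.periodic_mul {m : ℕ} {c : ℕ → Fin n} (h : IsClosedSeq B m c) (t k : ℕ) :
    c (t + k * m) = c t := by
  induction k with
  | zero => simp
  | succ k ih => rw [add_mul, one_mul, ← add_assoc, h.periodic, ih]

/-- The sum of `W` along a walk. -/
def walkSum (W : Matrix (Fin n) (Fin n) ℤ) {G : SimpleGraph (Fin n)} :
    {u v : Fin n} → G.Walk u v → ℤ
  | _, _, .nil => 0
  | u, _, .cons (v := v) _ p => W u v + walkSum W p

theorem walkSum_append {G : SimpleGraph (Fin n)} {u v w : Fin n} (p : G.Walk u v)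
    (q : G.Walk v w) : walkSum W (p.append q) = walkSum W p + walkSum W q := by
  induction p with
  | nil => simp [walkSum]
  | cons h p ih => rw [SimpleGraph.Walk.cons_append, walkSum, walkSum, ih, add_assoc]

theorem walkSum_reverse (hW : ∀ i j, W j i = -W i j) {G : SimpleGraph (Fin n)} {u v : Fin n}
    (p : G.Walk u v) : walkSum W p.reverse = -walkSum W p := by
  induction p with
  | nil => simp [walkSum]
  | @cons u v w h p ih =>
    rw [SimpleGraph.Walk.reverse_cons, walkSum_append, ih, walkSum, walkSum, walkSum, hW u v]
    ring

theorem walkSum_eq_seqSum {G : SimpleGraph (Fin n)} {u v : Fin n} (p : G.Walk u v) :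
    walkSum W p = seqSum W p.length p.getVert := by
  induction p with
  | nil => simp [walkSum, seqSum]
  | cons h p ih =>
    rw [walkSum, ih, SimpleGraph.Walk.length_cons, seqSum, seqSum, Finset.sum_range_succ', add_comm]
    simp [SimpleGraph.Walk.getVert_cons_succ]

/-- A function on the arrows whose sum along every closed walk vanishes is a coboundary. -/
theorem exists_potential_of_seqSum_eq_zero (hB : ∀ i j, B j i = -B i j)
    (hW : ∀ i j, W j i = -W i j)
    (h : ∀ m c, IsClosedSeq B m c → seqSum W m c = 0) :
    ∃ b : Fin n → ℤ, ∀ i j, B i j ≠ 0 → W i j = b j - b i := by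
  let G : SimpleGraph (Fin n) :=
    { Adj := fun i j => B i j ≠ 0
      symm := ⟨fun i j hij => by rw [hB i j]; exact neg_ne_zero.mpr hij⟩
      loopless := ⟨fun i hi => hi (by have := hB i i; omega)⟩ }
  have hclosed : ∀ u (p : G.Walk u u), walkSum W p = 0 := by
    intro u p
    rcases Nat.eq_zero_or_pos p.length with hl | hl
    · rw [walkSum_eq_seqSum, hl]; simp [seqSum]
    · obtain ⟨c, hc, hcs⟩ := exists_isClosedSeq (B := B) (W := W) (P := p.getVert) hl
        (fun t ht => p.adj_getVert_succ ht) (by simp)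
      rw [walkSum_eq_seqSum, ← hcs, h _ c hc]
  have hex : ∀ (C : G.ConnectedComponent) v, G.connectedComponentMk v = C →
      Nonempty (G.Walk (Quot.out C) v) := by
    rintro _ v rfl
    exact SimpleGraph.ConnectedComponent.exact (Quot.out_eq _)
  let w := fun C v hv => (hex C v hv).some
  have hw : ∀ C v (hv : G.connectedComponentMk v = C),
      walkSum W (w C v hv) = walkSum W (w _ v rfl) := by
    rintro _ v rfl; rfl
  refine ⟨fun v => walkSum W (w _ v rfl), fun i j hij => ?_⟩
  have hadj : G.Adj i j := hij
  have hji : G.connectedComponentMk j = G.connectedComponentMk i :=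
    SimpleGraph.ConnectedComponent.sound hadj.reachable.symm
  have := hclosed _ ((w _ i rfl).append (.cons hadj (w _ j hji).reverse))
  rw [walkSum_append, walkSum, walkSum_reverse hW, hw _ j hji] at this
  beta_reduce
  linarith

/-- A chordless oriented cycle of length `m`, as an `m`-periodic sequence. -/
structure IsOrientedCycleSeq (B : Matrix (Fin n) (Fin n) ℤ) (m : ℕ) (c : ℕ → Fin n) : Prop where
  three_le : 3 ≤ m
  periodic : ∀ t, c (t + m) = c t
  arrow : ∀ t, 0 < B (c t) (c (t + 1))
  ne : ∀ a l, 0 < l → l < m → c (a + l) ≠ c a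
  chordless : ∀ a l, 2 ≤ l → l + 2 ≤ m → B (c a) (c (a + l)) = 0

section Minimal

variable {m : ℕ} {c : ℕ → Fin n}

theorem IsClosedSeq.three_le (hB : ∀ i j, B j i = -B i j) (hW : ∀ i j, W j i = -W i j)
    (hc : IsClosedSeq B m c) (hs : seqSum W m c ≠ 0) : 3 ≤ m := by
  by_contra hlt
  have : m = 0 ∨ m = 1 ∨ m = 2 := by omega
  rcases this with rfl | rfl | rfl
  · exact hs rfl
  · have h1 := hc.periodic 0
    have h2 := hc.adj 0
    rw [h1] at h2
    have := hB (c 0) (c 0)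
    omega
  · have h1 : c 2 = c 0 := hc.periodic 0
    apply hs
    simp only [seqSum, Finset.sum_range_succ, Finset.sum_range_zero, zero_add, Nat.reduceAdd, h1]
    rw [hW]; ring

theorem IsClosedSeq.zero_ne (hc : IsClosedSeq B m c) (hs : seqSum W m c ≠ 0)
    (hmin : ∀ k < m, ∀ d, IsClosedSeq B k d → seqSum W k d = 0) {l : ℕ} (h0 : 0 < l)
    (hl : l < m) : c l ≠ c 0 := by
  intro e
  obtain ⟨k, rfl⟩ : ∃ k, m = l + k := ⟨m - l, by omega⟩
  obtain ⟨d₁, hd₁, hs₁⟩ := exists_isClosedSeq (W := W) h0 (fun t _ => hc.adj t) e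
  obtain ⟨d₂, hd₂, hs₂⟩ := exists_isClosedSeq (W := W) (P := fun t => c (l + t)) (m := k)
    (by omega) (fun t _ => hc.adj (l + t)) (by
      have := hc.periodic 0
      rw [zero_add] at this
      rw [this, add_zero, e])
  rw [hmin l hl d₁ hd₁] at hs₁
  rw [hmin k (by omega) d₂ hd₂] at hs₂
  rw [seqSum_add, ← hs₁, ← hs₂] at hs
  exact hs rfl

theorem IsClosedSeq.zero_chordless (hB : ∀ i j, B j i = -B i j) (hW : ∀ i j, W j i = -W i j)
    (hc : IsClosedSeq B m c) (hs : seqSum W m c ≠ 0)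
    (hmin : ∀ k < m, ∀ d, IsClosedSeq B k d → seqSum W k d = 0) {l : ℕ} (h0 : 2 ≤ l)
    (hl : l + 2 ≤ m) : B (c 0) (c l) = 0 := by
  by_contra hne
  obtain ⟨k, rfl⟩ : ∃ k, m = l + k := ⟨m - l, by omega⟩
  have e : c (l + k) = c 0 := by
    have := hc.periodic 0
    rwa [zero_add] at this
  have hd₁ := isClosedSeq_mod (m := l) (fun t _ => hc.adj t)
    (by rw [hB]; exact neg_ne_zero.mpr hne)
  have hd₂ := isClosedSeq_mod (P := fun t => c (l + t)) (m := k) (fun t _ => hc.adj (l + t))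
    (by rw [e]; exact hne)
  have hs₁ := hmin _ (by omega) _ hd₁
  have hs₂ := hmin _ (by omega) _ hd₂
  rw [seqSum_mod, hW] at hs₁
  rw [seqSum_mod (fun t => c (l + t)), e, add_zero] at hs₂
  rw [seqSum_add] at hs
  exact hs (by linarith)

theorem IsClosedSeq.mul_pos_of_minimal (hB : ∀ i j, B j i = -B i j)
    (hor : ¬ HasNonorientedCycle B) (hm : 3 ≤ m) (hc : IsClosedSeq B m c)
    (hne : ∀ a l, 0 < l → l < m → c (a + l) ≠ c a)
    (hch : ∀ a l, 2 ≤ l → l + 2 ≤ m → B (c a) (c (a + l)) = 0) (r : ℕ) :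
    0 < B (c r) (c (r + 1)) * B (c (r + 1)) (c (r + 1 + 1)) := by
  by_contra hle
  have hlt : B (c r) (c (r + 1)) * B (c (r + 1)) (c (r + 1 + 1)) < 0 :=
    lt_of_le_of_ne (not_lt.mp hle) (mul_ne_zero (hc.adj _) (hc.adj _))
  have hr : c (r + 1 + 1 + (m - 2)) = c r := by
    rw [show r + 1 + 1 + (m - 2) = r + m by omega, hc.periodic]
  refine hor ⟨c (r + 1), c (r + 1 + 1), c (r + 1 + 1 + (m - 2)), (hne _ _ (by omega)
    (by omega)).symm, ?_, ?_⟩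
  · rw [hr, hB (c r) (c (r + 1))]; linarith
  · refine reflTransGen_of_seq (fun t => c (r + 1 + 1 + t)) (Nat.zero_le _) fun t _ ht =>
      ⟨hc.adj _, ?_, fun h => ?_⟩
    · rw [show r + 1 + 1 + (t + 1) = r + 1 + (t + 2) by ring]
      exact hne _ _ (by omega) (by omega)
    · right
      rcases Nat.lt_or_ge (t + 1) (m - 2) with h1 | h1
      · rw [show r + 1 + 1 + (t + 1) = r + 1 + (t + 2) by ring] at h
        exact absurd (hch _ _ (by omega) (by omega)) h
      · rw [show t + 1 = m - 2 by omega]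

end Minimal

theorem IsClosedSeq.reverse (hB : ∀ i j, B j i = -B i j) {m : ℕ} {c : ℕ → Fin n} (hm : 0 < m)
    (hc : IsClosedSeq B m c) : IsClosedSeq B m (fun t => c (t * (m - 1))) := by
  obtain ⟨k, rfl⟩ : ∃ k, m = k + 1 := ⟨m - 1, by omega⟩
  refine ⟨fun t => ?_, fun t => ?_⟩
  · rw [show (t + (k + 1)) * (k + 1 - 1) = t * k + k * (k + 1) by simp; ring, hc.periodic_mul]
    rfl
  · rw [hB, neg_ne_zero, show c (t * (k + 1 - 1)) = c ((t + 1) * (k + 1 - 1) + 1) by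
      rw [show (t + 1) * (k + 1 - 1) + 1 = t * k + (k + 1) by simp; ring, hc.periodic]; rfl]
    exact hc.adj _

theorem IsClosedSeq.seqSum_reverse (hW : ∀ i j, W j i = -W i j) {m : ℕ} {c : ℕ → Fin n}
    (hm : 0 < m) (hc : IsClosedSeq B m c) :
    seqSum W m (fun t => c (t * (m - 1))) = -seqSum W m c := by
  obtain ⟨k, rfl⟩ : ∃ k, m = k + 1 := ⟨m - 1, by omega⟩
  have hval : ∀ t s, t + s = k + 1 → c (t * k) = c s := by
    intro t s hts
    rcases Nat.eq_zero_or_pos t with rfl | ht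
    · rw [zero_mul, show s = 0 + (k + 1) by omega, hc.periodic]
    · obtain ⟨u, rfl⟩ : ∃ u, t = u + 1 := ⟨t - 1, by omega⟩
      rw [← hc.periodic_mul s u]
      congr 1
      obtain rfl : k = u + s := by omega
      ring
  rw [seqSum, seqSum, ← Finset.sum_range_reflect, ← Finset.sum_neg_distrib]
  refine Finset.sum_congr rfl fun t ht => ?_
  rw [Finset.mem_range] at ht
  simp only [Nat.add_sub_cancel]
  rw [hval (k - t) (t + 1) (by omega), hval (k - t + 1) t (by omega), hW]

/-- If `W` is not a coboundary, then its sum along some chordless oriented cycle is nonzero. -/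
theorem exists_isOrientedCycleSeq (hB : ∀ i j, B j i = -B i j) (hW : ∀ i j, W j i = -W i j)
    (hor : ¬ HasNonorientedCycle B)
    (h : ¬ ∃ b : Fin n → ℤ, ∀ i j, B i j ≠ 0 → W i j = b j - b i) :
    ∃ m c, IsOrientedCycleSeq B m c ∧ seqSum W m c ≠ 0 := by
  classical
  have hex : ∃ m c, IsClosedSeq B m c ∧ seqSum W m c ≠ 0 := by
    by_contra hno
    push Not at hno
    exact h (exists_potential_of_seqSum_eq_zero hB hW hno)
  obtain ⟨c, hc, hs⟩ := Nat.find_spec hex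
  have hmin : ∀ k < Nat.find hex, ∀ d, IsClosedSeq B k d → seqSum W k d = 0 := by
    intro k hk d hd
    by_contra hne
    exact Nat.find_min hex hk ⟨d, hd, hne⟩
  generalize Nat.find hex = m at *
  have h3 := hc.three_le hB hW hs
  have hne : ∀ d, IsClosedSeq B m d → seqSum W m d ≠ 0 → ∀ a l, 0 < l → l < m →
      d (a + l) ≠ d a := fun d hd hsd a l =>
    (hd.shift a).zero_ne (by rwa [hd.seqSum_shift]) hmin
  have hch : ∀ d, IsClosedSeq B m d → seqSum W m d ≠ 0 → ∀ a l, 2 ≤ l → l + 2 ≤ m →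
      B (d a) (d (a + l)) = 0 := fun d hd hsd a l =>
    (hd.shift a).zero_chordless hB hW (by rwa [hd.seqSum_shift]) hmin
  have hsign := hc.mul_pos_of_minimal hB hor h3 (hne c hc hs) (hch c hc hs)
  rcases (hc.adj 0).lt_or_gt with hneg | hpos
  · have hall : ∀ t, B (c t) (c (t + 1)) < 0 := by
      intro t
      induction t with
      | zero => exact hneg
      | succ t ih => exact neg_of_mul_pos_right (hsign t) ih.le
    have hr := hc.reverse hB (by omega)
    have hrs : seqSum W m (fun t => c (t * (m - 1))) ≠ 0 := by
      rw [hc.seqSum_reverse hW (by omega)]; exact neg_ne_zero.mpr hs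
    refine ⟨m, _, ⟨h3, hr.periodic, fun t => ?_, hne _ hr hrs, hch _ hr hrs⟩, hrs⟩
    rw [hB, neg_pos, show c (t * (m - 1)) = c ((t + 1) * (m - 1) + 1) by
      rw [add_mul, one_mul, add_assoc, Nat.sub_add_cancel (by omega), hc.periodic]]
    exact hall _
  · refine ⟨m, c, ⟨h3, hc.periodic, fun t => ?_, hne c hc hs, hch c hc hs⟩, hs⟩
    induction t with
    | zero => exact hpos
    | succ t ih => exact pos_of_mul_pos_right (hsign t) ih.le

end DiscreteCycles

section CycleSequences

variable {n : ℕ} {B : Matrix (Fin n) (Fin n) ℤ} {m : ℕ} {c : ℕ → Fin n}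

namespace IsOrientedCycleSeq

theorem periodic_mul (h : IsOrientedCycleSeq B m c) (t k : ℕ) : c (t + k * m) = c t :=
  IsClosedSeq.periodic_mul ⟨h.periodic, fun t => (h.arrow t).ne'⟩ t k

theorem exists_lt (h : IsOrientedCycleSeq B m c) (a u : ℕ) :
    ∃ k < m, ∀ s, c (u + s) = c (a + k + s) := by
  have hm := h.three_le
  have hle : a ≤ a * m := Nat.le_mul_of_pos_right _ (by omega)
  refine ⟨(u + a * m - a) % m, Nat.mod_lt _ (by omega), fun s => ?_⟩
  rw [← h.periodic_mul (u + s) a, ← h.periodic_mul (a + _ + s) ((u + a * m - a) / m)]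
  congr 1
  have := Nat.mod_add_div' (u + a * m - a) m
  omega

theorem eq_of_lt (h : IsOrientedCycleSeq B m c) {a k l : ℕ} (hk : k < m) (hl : l < m)
    (e : c (a + k) = c (a + l)) : k = l := by
  rcases lt_trichotomy k l with hlt | rfl | hlt
  · refine absurd e.symm ?_
    rw [show a + l = a + k + (l - k) by omega]
    exact h.ne _ _ (by omega) (by omega)
  · rfl
  · refine absurd e ?_
    rw [show a + k = a + l + (k - l) by omega]
    exact h.ne _ _ (by omega) (by omega)

theorem exists_of_arrow (hB : ∀ i j, B j i = -B i j) (h : IsOrientedCycleSeq B m c) {u v : ℕ}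
    (huv : 0 < B (c u) (c v)) : ∃ t, c t = c u ∧ c (t + 1) = c v := by
  have hm := h.three_le
  obtain ⟨k, hk, hkv⟩ := h.exists_lt u v
  have e : c v = c (u + k) := hkv 0
  rw [e] at huv ⊢
  have hcases : k = 0 ∨ k = 1 ∨ (2 ≤ k ∧ k + 2 ≤ m) ∨ k = m - 1 := by omega
  rcases hcases with rfl | rfl | ⟨h2, h2'⟩ | rfl
  · have := hB (c u) (c u)
    rw [add_zero] at huv
    omega
  · exact ⟨u, rfl, rfl⟩
  · exact absurd (h.chordless u k h2 h2') huv.ne'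
  · have := h.arrow (u + (m - 1))
    rw [show u + (m - 1) + 1 = u + m by omega, h.periodic, hB] at this
    omega

theorem apply_finRotate (h : IsOrientedCycleSeq B m c) (i : Fin m) :
    c (finRotate m i) = c (i + 1) := by
  obtain ⟨k, rfl⟩ : ∃ k, m = k + 1 := ⟨m - 1, by have := h.three_le; omega⟩
  rw [coe_finRotate]
  split_ifs with hi
  · rw [hi, Fin.val_last, ← h.periodic 0, zero_add]
  · rfl

/-- The sum of `W` along the cycle is the only obstruction to `W` being a coboundary, once one
arrow of the cycle is removed. -/
theorem exists_potential (h : IsOrientedCycleSeq B m c) (W : Matrix (Fin n) (Fin n) ℤ) (a : ℕ) :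
    ∃ b : Fin n → ℤ, ∀ u, W (c u) (c (u + 1)) = b (c (u + 1)) - b (c u) ∨
      c u = c a ∧ c (u + 1) = c (a + 1) := by
  classical
  let idx : Fin n → ℕ := fun v =>
    if hv : ∃ k < m, c (a + 1 + k) = v then hv.choose else 0
  have hidx : ∀ k < m, idx (c (a + 1 + k)) = k := by
    intro k hk
    have hex : ∃ l < m, c (a + 1 + l) = c (a + 1 + k) := ⟨k, hk, rfl⟩
    have hs := hex.choose_spec
    simp only [idx, dif_pos hex]
    exact h.eq_of_lt hs.1 hk hs.2
  refine ⟨fun v => seqSum W (idx v) fun t => c (a + 1 + t), fun u => ?_⟩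
  obtain ⟨k, hk, hku⟩ := h.exists_lt (a + 1) u
  have e0 : c u = c (a + 1 + k) := hku 0
  have e1 : c (u + 1) = c (a + 1 + (k + 1)) := hku 1
  rcases Nat.lt_or_ge (k + 1) m with hlt | hge
  · left
    beta_reduce
    rw [e0, e1, hidx k hk, hidx (k + 1) hlt, seqSum, Finset.sum_range_succ, seqSum]
    ring
  · right
    obtain rfl : m = k + 1 := by omega
    rw [e0, e1, show a + 1 + k = a + (k + 1) by ring, h.periodic, ← add_assoc (a + 1),
      show a + 1 + k + 1 = a + 1 + (k + 1) by ring, h.periodic]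
    exact ⟨rfl, rfl⟩

end IsOrientedCycleSeq

end CycleSequences

section PlaneComponents

theorem frontier_connectedComponentIn_subset {U : Set (ℝ × ℝ)} (hU : IsOpen U) (x : ℝ × ℝ) :
    frontier (connectedComponentIn U x) ⊆ Uᶜ := by
  intro z hz hzU
  rw [hU.connectedComponentIn.frontier_eq] at hz
  obtain ⟨y, hyz, hyx⟩ := mem_closure_iff.mp hz.1 _ hU.connectedComponentIn
    (mem_connectedComponentIn hzU)
  apply hz.2
  rw [connectedComponentIn_eq hyx, ← connectedComponentIn_eq hyz]
  exact mem_connectedComponentIn hzU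

theorem IsCompact.unboundedPart_nonempty {K : Set (ℝ × ℝ)} (hK : IsCompact K) :
    (unboundedPart K).Nonempty := by
  obtain ⟨R, hR⟩ := hK.isBounded.subset_closedBall 0
  let ray : Set (ℝ × ℝ) := (fun t : ℝ => (t, (0 : ℝ))) '' Set.Ioi (max R 0)
  have hray : ray ⊆ Kᶜ := by
    rintro _ ⟨t, ht, rfl⟩ hz
    have h1 := hR hz
    rw [mem_closedBall_zero_iff] at h1
    have h2 := (norm_fst_le (t, (0 : ℝ))).trans h1
    have h3 : max R 0 < t := ht
    have h4 := le_abs_self t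
    rw [Real.norm_eq_abs] at h2
    exact absurd (le_max_left R 0) (by simp only at h2; linarith)
  have hmem : (max R 0 + 1, (0 : ℝ)) ∈ ray := ⟨_, by simp, rfl⟩
  have hconn : IsPreconnected ray :=
    isPreconnected_Ioi.image _ (by fun_prop)
  refine ⟨_, hray hmem, fun hb => ?_⟩
  have hb' := hb.subset (hconn.subset_connectedComponentIn hmem hray)
  obtain ⟨M, hM⟩ := hb'.subset_closedBall 0
  have h1 := hM ⟨max (max R 0) M + 1, by simp [Set.mem_Ioi]; grind, rfl⟩
  rw [mem_closedBall_zero_iff] at h1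
  have h2 := (norm_fst_le (max (max R 0) M + 1, (0 : ℝ))).trans h1
  rw [Real.norm_eq_abs] at h2
  have h3 := (le_abs_self _).trans h2
  simp only at h3
  have := le_max_right (max R 0) M
  linarith

end PlaneComponents

section CellBoundary

namespace PlaneEmb

variable {n : ℕ} {arr : Fin n → Fin n → Prop} (E : PlaneEmb arr)

/-- The union of the curves of some of the arrows. -/
def curves (used : Fin n → Fin n → Prop) : Set (ℝ × ℝ) :=
  ⋃ (i) (j) (h : arr i j) (_ : used i j), E.edge i j h '' Set.Icc 0 1

variable {E} {used : Fin n → Fin n → Prop}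

theorem mem_curves {z : ℝ × ℝ} : z ∈ E.curves used ↔
    ∃ i j, ∃ h : arr i j, used i j ∧ ∃ t ∈ Set.Icc (0 : ℝ) 1, E.edge i j h t = z := by
  simp only [curves, Set.mem_iUnion, Set.mem_image, exists_prop]

theorem isClosed_curves : IsClosed (E.curves used) :=
  (isCompact_iUnion fun i => isCompact_iUnion fun j => isCompact_iUnion fun h =>
    isCompact_iUnion fun _ => E.isCompact_edge i j h).isClosed

theorem curves_subset_image : E.curves used ⊆ E.image := by
  intro z hz
  obtain ⟨i, j, h, _, t, ht, rfl⟩ := mem_curves.mp hz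
  exact E.edge_mem_image h ht

theorem exists_used_of_vtx_mem_curves {v : Fin n} (hv : E.vtx v ∈ E.curves used) :
    ∃ i j, used i j ∧ (v = i ∨ v = j) := by
  obtain ⟨i, j, h, hu, t, ht, e⟩ := mem_curves.mp hv
  refine ⟨i, j, hu, ?_⟩
  rcases E.edge_eq_vtx ht e with ⟨_, rfl⟩ | ⟨_, rfl⟩
  · exact .inl rfl
  · exact .inr rfl

theorem edge_notMem_curves {i j : Fin n} (h : arr i j) (hu : ¬ used i j) {t : ℝ}
    (ht : t ∈ Set.Ioo (0 : ℝ) 1) : E.edge i j h t ∉ E.curves used := by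
  intro hz
  obtain ⟨i', j', h', hu', s, hs, e⟩ := mem_curves.mp hz
  have hne : (i, j) ≠ (i', j') := by
    rintro ⟨⟩
    exact hu hu'
  exact Set.eq_empty_iff_forall_notMem.mp (E.edge_disj i j h i' j' h' hne) _
    ⟨⟨t, ht, rfl⟩, ⟨s, hs, e⟩⟩

/-- If the used arrows form an induced subquiver, then all the other points of a nice embedding
lie in one component of the complement of their curves. -/
theorem Nice.image_subset (hE : E.Nice) {q : ℝ × ℝ} (hq : q ∈ unboundedPart E.image)
    (hind : ∀ i j, arr i j → E.vtx i ∈ E.curves used → E.vtx j ∈ E.curves used → used i j) :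
    E.image \ E.curves used ⊆ connectedComponentIn (E.curves used)ᶜ q := by
  have hvtx : ∀ v, E.vtx v ∉ E.curves used →
      E.vtx v ∈ connectedComponentIn (E.curves used)ᶜ q := by
    intro v hv
    have hpre : IsPreconnected (insert (E.vtx v) (unboundedPart E.image)) :=
      hE.1.subset_closure (Set.subset_insert _ _)
        (Set.insert_subset (hE.2 v) subset_closure)
    refine hpre.subset_connectedComponentIn (.inr hq) ?_ (.inl rfl)
    rintro z (rfl | hz)
    · exact hv
    · exact fun hzc => hz.1 (curves_subset_image hzc)
  have harc : ∀ i j (h : arr i j) (T : Set ℝ) (s t : ℝ), IsPreconnected T → T ⊆ Set.Icc 0 1 →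
      s ∈ T → t ∈ T → (∀ r ∈ T, E.edge i j h r ∉ E.curves used) →
      E.edge i j h s ∈ connectedComponentIn (E.curves used)ᶜ q →
      E.edge i j h t ∈ connectedComponentIn (E.curves used)ᶜ q := by
    intro i j h T s t hT hsub hs ht hc hmem
    rw [connectedComponentIn_eq hmem]
    refine (hT.image _ ((E.edge_cont i j h).mono hsub)).subset_connectedComponentIn
      ⟨s, hs, rfl⟩ ?_ ⟨t, ht, rfl⟩
    rintro _ ⟨r, hr, rfl⟩
    exact hc r hr
  rintro z ⟨hz | hz, hzc⟩
  · obtain ⟨v, rfl⟩ := hz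
    exact hvtx v hzc
  · simp only [Set.mem_iUnion] at hz
    obtain ⟨i, j, h, t, ht, rfl⟩ := hz
    have hu : ¬ used i j := fun hu => hzc (mem_curves.mpr ⟨i, j, h, hu, t, ht, rfl⟩)
    rcases eq_or_lt_of_le ht.1 with rfl | h0
    · rw [E.edge_src] at hzc ⊢
      exact hvtx i hzc
    rcases eq_or_lt_of_le ht.2 with rfl | h1
    · rw [E.edge_tgt] at hzc ⊢
      exact hvtx j hzc
    by_cases hi : E.vtx i ∈ E.curves used
    · have hj : E.vtx j ∉ E.curves used := fun hj => hu (hind i j h hi hj)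
      refine harc i j h (Set.Ioc 0 1) 1 t isPreconnected_Ioc Set.Ioc_subset_Icc_self (by simp)
        ⟨h0, ht.2⟩ (fun r hr => ?_) (by rw [E.edge_tgt]; exact hvtx j hj)
      rcases eq_or_lt_of_le hr.2 with rfl | hr1
      · rwa [E.edge_tgt]
      · exact edge_notMem_curves h hu ⟨hr.1, hr1⟩
    · refine harc i j h (Set.Ico 0 1) 0 t isPreconnected_Ico Set.Ico_subset_Icc_self (by simp)
        ⟨ht.1, h1⟩ (fun r hr => ?_) (by rw [E.edge_src]; exact hvtx i hi)
      rcases eq_or_lt_of_le hr.1 with rfl | hr0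
      · rwa [E.edge_src]
      · exact edge_notMem_curves h hu ⟨hr0, hr.2⟩

theorem edge_subset_of_Ioo {S : Set (ℝ × ℝ)} (hS : IsClosed S) {i j : Fin n} (h : arr i j)
    (hmem : ∀ t ∈ Set.Ioo (0 : ℝ) 1, E.edge i j h t ∈ S) : E.edge i j h '' Set.Icc 0 1 ⊆ S := by
  have hcl : closure (Set.Ioo (0 : ℝ) 1) = Set.Icc 0 1 := closure_Ioo zero_ne_one
  rw [← hcl]
  refine (ContinuousOn.image_closure (by rw [hcl]; exact E.edge_cont i j h)).trans
    (closure_minimal ?_ hS)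
  rintro _ ⟨t, ht, rfl⟩
  exact hmem t ht

end PlaneEmb

end CellBoundary

section Main

variable {n : ℕ} {B : Matrix (Fin n) (Fin n) ℤ}

/-- The defects of logarithms along the arrows of a quiver, as a skew-symmetric matrix. -/
def PlaneEmb.EdgeLogs.weight {E : PlaneEmb (fun i j : Fin n => 0 < B i j)} {φ : ℝ × ℝ → ℂ}
    (Λ : E.EdgeLogs φ) : Matrix (Fin n) (Fin n) ℤ :=
  Matrix.of fun i j => if 0 < B i j then Λ.defect i j else if 0 < B j i then -Λ.defect j i else 0

theorem PlaneEmb.EdgeLogs.weight_skew (hB : ∀ i j, B j i = -B i j)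
    {E : PlaneEmb (fun i j : Fin n => 0 < B i j)} {φ : ℝ × ℝ → ℂ} (Λ : E.EdgeLogs φ)
    (i j : Fin n) : Λ.weight j i = -Λ.weight i j := by
  have := hB i j
  simp only [weight, Matrix.of_apply]
  split_ifs <;> omega

theorem PlaneEmb.EdgeLogs.weight_eq {E : PlaneEmb (fun i j : Fin n => 0 < B i j)}
    {φ : ℝ × ℝ → ℂ} (Λ : E.EdgeLogs φ) {i j : Fin n} (h : 0 < B i j) :
    Λ.weight i j = Λ.defect i j := by
  rw [weight, Matrix.of_apply, if_pos h]

/-- The boundary of a bounded cell of a nice embedding consists of the curves of a chordless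
oriented cycle, provided that all cycles of the quiver are oriented. -/
theorem exists_isOrientedCycleSeq_frontier (hB : ∀ i j, B j i = -B i j)
    (hor : ¬ HasNonorientedCycle B) (E : PlaneEmb (fun i j : Fin n => 0 < B i j)) (hE : E.Nice)
    {x : ℝ × ℝ} (hx : x ∉ E.image)
    (hbd : Bornology.IsBounded (connectedComponentIn E.imageᶜ x)) :
    ∃ m c, IsOrientedCycleSeq B m c ∧ frontier (connectedComponentIn E.imageᶜ x) =
      E.curves fun i j => ∃ t, c t = i ∧ c (t + 1) = j := by
  obtain ⟨q, hq⟩ := E.isCompact_image.unboundedPart_nonempty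
  have hKo : IsOpen E.imageᶜ := E.isCompact_image.isClosed.isOpen_compl
  set F := connectedComponentIn E.imageᶜ x with hF
  have hxF : x ∈ F := mem_connectedComponentIn hx
  have hfr : frontier F ⊆ E.image := by
    simpa using frontier_connectedComponentIn_subset hKo x
  have hqF : q ∉ closure F := by
    intro h
    rw [closure_eq_self_union_frontier] at h
    rcases h with h | h
    · apply hq.2
      rwa [← connectedComponentIn_eq h]
    · exact hq.1 (hfr h)
  have hnolog := not_hasLogOn_frontier hbd hxF hqF
  obtain ⟨Λ⟩ := E.nonempty_edgeLogs (continuousOn_planeRatio x q hq.1) fun z hz =>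
    planeRatio_ne_zero (fun e => hx (e ▸ hz)) (fun e => hq.1 (e ▸ hz))
  obtain ⟨m, c, hc, hsum⟩ := exists_isOrientedCycleSeq hB (Λ.weight_skew hB) hor (by
    rintro ⟨b, hb⟩
    refine hnolog (Λ.hasLogOn isClosed_frontier (fun _ _ => True) (by
      simpa [PlaneEmb.image] using hfr) b
      fun i j h _ => .inl ?_)
    rw [← Λ.weight_eq h, hb i j h.ne'])
  refine ⟨m, c, hc, ?_⟩
  set used : Fin n → Fin n → Prop := fun i j => ∃ t, c t = i ∧ c (t + 1) = j with hused
  have hCK : E.curves used ⊆ E.image := PlaneEmb.curves_subset_image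
  have hnologC : ¬ HasLogOn (planeRatio x q) (E.curves used) := by
    intro hlog
    obtain ⟨β, hβ⟩ := Λ.exists_potential hlog
    apply hsum
    have : ((seqSum Λ.weight m c : ℤ) : ℂ) = 0 := by
      rw [seqSum, Int.cast_sum, Finset.sum_congr rfl fun t _ => (show
        ((Λ.weight (c t) (c (t + 1)) : ℤ) : ℂ) = β (c (t + 1)) - β (c t) by
          rw [Λ.weight_eq (hc.arrow t)]
          refine hβ _ _ (hc.arrow t) ?_
          rintro _ ⟨s, hs, rfl⟩
          exact PlaneEmb.mem_curves.mpr ⟨_, _, hc.arrow t, ⟨t, rfl, rfl⟩, s, hs, rfl⟩),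
        Finset.sum_range_sub (fun t => β (c t)), ← hc.periodic 0, zero_add, sub_self]
    exact_mod_cast this
  have hCo : IsOpen (E.curves used)ᶜ := PlaneEmb.isClosed_curves.isOpen_compl
  have hqC : q ∈ (E.curves used)ᶜ := fun h => hq.1 (hCK h)
  have hxC : x ∈ (E.curves used)ᶜ := fun h => hx (hCK h)
  have hxq : x ∉ connectedComponentIn (E.curves used)ᶜ q := fun h =>
    hnologC (hasLogOn_planeRatio PlaneEmb.isClosed_curves isPreconnected_connectedComponentIn
      (connectedComponentIn_subset _ _) h (mem_connectedComponentIn hqC))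
  have hon : ∀ v, E.vtx v ∈ E.curves used → ∃ t, c t = v := by
    intro v hv
    obtain ⟨_, _, ⟨t, rfl, rfl⟩, rfl | rfl⟩ := PlaneEmb.exists_used_of_vtx_mem_curves hv
    exacts [⟨_, rfl⟩, ⟨_, rfl⟩]
  have hrest := hE.image_subset (used := used) hq fun i j hij hi hj => by
    obtain ⟨u, rfl⟩ := hon i hi
    obtain ⟨v, rfl⟩ := hon j hj
    exact hc.exists_of_arrow hB hij
  have hFC : F = connectedComponentIn (E.curves used)ᶜ x := by
    refine (isPreconnected_connectedComponentIn.subset_connectedComponentIn hxF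
      ((connectedComponentIn_subset _ _).trans (Set.compl_subset_compl.mpr hCK))).antisymm ?_
    refine isPreconnected_connectedComponentIn.subset_connectedComponentIn
      (mem_connectedComponentIn hxC) fun z hz hzK => hxq ?_
    have hzq := hrest ⟨hzK, connectedComponentIn_subset _ _ hz⟩
    rw [connectedComponentIn_eq hzq, ← connectedComponentIn_eq hz]
    exact mem_connectedComponentIn hxC
  have hfrC : frontier F ⊆ E.curves used := by
    rw [hFC]
    simpa using frontier_connectedComponentIn_subset hCo x
  refine hfrC.antisymm fun z hz => ?_
  obtain ⟨_, _, h, ⟨a, rfl, rfl⟩, s, hs, rfl⟩ := PlaneEmb.mem_curves.mp hz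
  refine PlaneEmb.edge_subset_of_Ioo isClosed_frontier h (fun t₀ ht₀ => ?_) ⟨s, hs, rfl⟩
  by_contra hcut
  obtain ⟨b, hb⟩ := hc.exists_potential Λ.weight a
  refine hnolog (Λ.hasLogOn isClosed_frontier used
    (hfrC.trans Set.subset_union_right) b ?_)
  rintro _ _ h' ⟨u, rfl, rfl⟩
  rcases hb u with hu | ⟨e0, e1⟩
  · left
    rw [← Λ.weight_eq h', hu]
  · right
    refine ⟨t₀, ht₀, ?_⟩
    clear hb
    revert h'
    rw [e0, e1]
    exact fun _ => hcut

end Main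

/-- Corollary: in a nice embedding, the boundary of each bounded cell
is an oriented cycle of the quiver, and there are no other edges between its
vertices.  Let `Q` be a cluster quiver of simply laced finite type with a nice plane
embedding `E`, and let `U` be a bounded connected component of the complement of the
image of `E`.  Then there is an oriented cycle `c : Fin m → Fin n` (`m ≥ 3`) of `Q`
whose edge curves form exactly the boundary of `U`, and every arrow of `Q` between
vertices of the cycle is one of the arrows of the cycle. -/
theorem boundary_of_bounded_cell_is_oriented_cycle {n : ℕ}
    (B : Matrix (Fin n) (Fin n) ℤ) (hB : IsFiniteTypeClusterMatrix B)
    (E : PlaneEmb (fun i j : Fin n => 0 < B i j)) (hE : E.Nice)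
    (x : ℝ × ℝ) (hx : x ∉ E.image)
    (hbd : Bornology.IsBounded (connectedComponentIn E.imageᶜ x)) :
    ∃ (m : ℕ) (_ : 3 ≤ m) (c : Fin m → Fin n), Function.Injective c ∧
      (∃ harr : ∀ i : Fin m, 0 < B (c i) (c (finRotate m i)),
        frontier (connectedComponentIn E.imageᶜ x) =
          ⋃ i : Fin m, E.edge (c i) (c (finRotate m i)) (harr i) '' Set.Icc 0 1) ∧
      ∀ a b : Fin n, 0 < B a b → (∃ i, c i = a) → (∃ j, c j = b) →
        ∃ i : Fin m, c i = a ∧ c (finRotate m i) = b := by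
  have hgood := hB.isGoodMatrix
  obtain ⟨m, c, hc, hfr⟩ :=
    exists_isOrientedCycleSeq_frontier hgood.skew hgood.oriented E hE hx hbd
  have hlt : ∀ u, ∃ i : Fin m, c i = c u ∧ c (i + 1) = c (u + 1) := by
    intro u
    obtain ⟨k, hk, hku⟩ := hc.exists_lt 0 u
    simp only [zero_add] at hku
    exact ⟨⟨k, hk⟩, (hku 0).symm, (hku 1).symm⟩
  refine ⟨m, hc.three_le, fun i => c i, fun i j hij => ?_, ⟨fun i => ?_, ?_⟩, ?_⟩
  · exact Fin.ext (hc.eq_of_lt (a := 0) i.2 j.2 (by simpa using hij))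
  · beta_reduce
    rw [hc.apply_finRotate]
    exact hc.arrow i
  · rw [hfr]
    ext z
    rw [PlaneEmb.mem_curves, Set.mem_iUnion]
    constructor
    · rintro ⟨_, _, h, ⟨u, rfl, rfl⟩, t, ht, rfl⟩
      obtain ⟨i, h0, h1⟩ := hlt u
      refine ⟨i, t, ht, ?_⟩
      congr 1
      beta_reduce
      rw [hc.apply_finRotate, h1]
    · rintro ⟨i, t, ht, rfl⟩
      exact ⟨_, _, _, ⟨i, rfl, (hc.apply_finRotate i).symm⟩, t, ht, rfl⟩
  · rintro _ _ hab ⟨i, rfl⟩ ⟨j, rfl⟩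
    obtain ⟨u, h0, h1⟩ := hc.exists_of_arrow hgood.skew hab
    obtain ⟨k, hk0, hk1⟩ := hlt u
    exact ⟨k, hk0.trans h0, (hc.apply_finRotate k).trans (hk1.trans h1)⟩

end
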